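/- Let C be a smooth connected projective complex curve of genus g and L any line bundle on C of degree ≥ 2g+2. Then the algebra R_L = ⊕_{n≥0} H^0(C, L^n) is Koszul. -/

import Mathlib

open TensorProduct Function

noncomputable section


/-!  ### Graded algebras presented by their components

An ℕ-graded algebra `R = ⊕ₙ Rₙ` over a field `k` (with `R₀ = k`) is presented here through
its graded components, realized as `k`-subspaces `piece n` of an ambient `k`-algebra `A`,
with `1 ∈ piece 0` and `piece m * piece n ⊆ piece (m + n)`.  All notions below (Koszulness,
quadraticity) depend only on the components and the componentwise multiplication maps. -/
structure GradedSystem (k A : Type) [Field k] [Ring A] [Algebra k A] where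
  piece : ℕ → Submodule k A
  one_mem : (1 : A) ∈ piece 0
  mul_mem : ∀ {m n : ℕ} {x y : A}, x ∈ piece m → y ∈ piece n → x * y ∈ piece (m + n)

namespace GradedSystem

variable {k A : Type} [Field k] [Ring A] [Algebra k A] (S : GradedSystem k A)

/-- The componentwise multiplication map `Rₘ ⊗ Rₙ → R_{m+n}`. -/
def mulMap (m n : ℕ) : S.piece m →ₗ[k] S.piece n →ₗ[k] S.piece (m + n) :=
  LinearMap.mk₂ k (fun x y => ⟨(x : A) * (y : A), S.mul_mem x.2 y.2⟩)
    (fun x x' y => Subtype.ext (by simp [add_mul]))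
    (fun c x y => Subtype.ext (by simp [smul_mul_assoc]))
    (fun x y y' => Subtype.ext (by simp [mul_add]))
    (fun c x y => Subtype.ext (by simp [mul_smul_comm]))

/-- Transport of a graded component along an equality of degrees. -/
def cast {m n : ℕ} (h : m = n) : (S.piece m : Type) ≃ₗ[k] S.piece n :=
  LinearEquiv.ofEq _ _ (by rw [h])

/-- The degree-`d` component of the differential
`V_{i+1} ⊗ R(-(i+1)) → V_i ⊗ R(-i)` of a complex of free graded (right) `R`-modules with
`V_i = k^{n i}` generated in degree `i`; the differential is encoded by its
restriction `φ i : V_{i+1} → V_i ⊗ R₁` to the generators (a "matrix of linear forms").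
The degree-`(i+1+d)` component of the map is `V_{i+1} ⊗ R_d → V_i ⊗ R_{d+1}`. -/
def Dmap (n : ℕ → ℕ)
    (φ : ∀ i : ℕ, (Fin (n (i + 1)) → k) →ₗ[k] ((Fin (n i) → k) ⊗[k] S.piece 1))
    (i d : ℕ) :
    ((Fin (n (i + 1)) → k) ⊗[k] S.piece d) →ₗ[k] ((Fin (n i) → k) ⊗[k] S.piece (d + 1)) :=
  (LinearMap.lTensor (Fin (n i) → k)
      ((S.cast (add_comm 1 d)).toLinearMap ∘ₗ TensorProduct.lift (S.mulMap 1 d))) ∘ₗ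
    (TensorProduct.assoc k (Fin (n i) → k) (S.piece 1) (S.piece d)).toLinearMap ∘ₗ
    (LinearMap.rTensor (S.piece d) (φ i))

/-- `S` is connected: the degree-zero component is spanned by the unit, i.e. `R₀ = k`. -/
def ConnectedOne : Prop := S.piece 0 = Submodule.span k {(1 : A)}

/-- `S` is a *Koszul algebra*: `R₀ = k` and the trivial module `k` admits a linear free
resolution `⋯ → V₂ ⊗ R(-2) → V₁ ⊗ R(-1) → R → k → 0` (this is one of the standard
equivalent definitions of Koszulness: `Extⁿ(k, k(-m)) = 0` for `n ≠ m`).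
Exactness is expressed by its graded components: surjectivity of `V₁ ⊗ R_d → R_{d+1}`
(exactness at `R` in positive degrees), injectivity of `V_{i+1} ⊗ R₀ → V_i ⊗ R₁`
(exactness in the lowest degree at each spot), and `range = ker` elsewhere. -/
def IsKoszul : Prop :=
  S.ConnectedOne ∧
  ∃ (n : ℕ → ℕ)
    (φ : ∀ i : ℕ, (Fin (n (i + 1)) → k) →ₗ[k] ((Fin (n i) → k) ⊗[k] S.piece 1)),
    n 0 = 1 ∧
    (∀ d : ℕ, Surjective (S.Dmap n φ 0 d)) ∧
    (∀ i : ℕ, Injective (S.Dmap n φ i 0)) ∧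
    (∀ i d : ℕ, LinearMap.range (S.Dmap n φ (i + 1) d) = LinearMap.ker (S.Dmap n φ i (d + 1)))

/-- `S` is a *quadratic algebra*: `R₀ = k`, `R` is generated by `R₁` and its relations are
generated in degree `2`; equivalently there is an exact sequence
`V₂ ⊗ R(-2) → V₁ ⊗ R(-1) → R → k → 0` (exact at `V₁ ⊗ R(-1)` and at `R`). -/
def IsQuadratic : Prop :=
  S.ConnectedOne ∧
  ∃ (n : ℕ → ℕ)
    (φ : ∀ i : ℕ, (Fin (n (i + 1)) → k) →ₗ[k] ((Fin (n i) → k) ⊗[k] S.piece 1)),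
    n 0 = 1 ∧
    (∀ d : ℕ, Surjective (S.Dmap n φ 0 d)) ∧
    Injective (S.Dmap n φ 0 0) ∧
    (∀ d : ℕ, LinearMap.range (S.Dmap n φ 1 d) = LinearMap.ker (S.Dmap n φ 0 (d + 1)))

end GradedSystem

/-- For `m = 1`, the canonical identification `(k^m) ⊗ M ≃ M`. -/
def oneTensorEquiv {k : Type} [Field k] {m : ℕ} (h : m = 1) (M : Type)
    [AddCommGroup M] [Module k M] : ((Fin m → k) ⊗[k] M) ≃ₗ[k] M :=
  (TensorProduct.congr
      ((LinearEquiv.funCongrLeft k k (finCongr h.symm)).trans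
        (LinearEquiv.funUnique (Fin 1) k k))
      (LinearEquiv.refl k M)).trans (TensorProduct.lid k M)


/-!  ### Smooth connected projective complex curves

A smooth connected projective curve over `ℂ` is (equivalently) presented through its
function field `F` — a finitely generated extension of `ℂ` of transcendence degree 1 —
together with its set of points (= places of `F/ℂ`), each point giving an
order-of-vanishing valuation `ord P : F → ℤ`.  Divisors are finitely supported `ℤ`-valued
functions on points, and `H⁰(C, O(D))` is the Riemann–Roch space of `D`. -/
structure PreCurve where
  /-- the function field of the curve -/
  F : Type
  [fieldF : Field F]
  [algF : Algebra ℂ F]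
  /-- `F` is a finitely generated extension of `ℂ` of transcendence degree 1 -/
  trdeg_one : ∃ x : F, Transcendental ℂ x ∧
    FiniteDimensional (IntermediateField.adjoin ℂ {x}) F
  /-- the (closed) points of the curve -/
  Point : Type
  /-- order of vanishing of a rational function at a point -/
  ord : Point → F → ℤ
  ord_zero' : ∀ P, ord P 0 = 0
  ord_mul : ∀ P, ∀ f g : F, f ≠ 0 → g ≠ 0 → ord P (f * g) = ord P f + ord P g
  ord_add : ∀ P, ∀ f g : F, f ≠ 0 → g ≠ 0 → f + g ≠ 0 →
    min (ord P f) (ord P g) ≤ ord P (f + g)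
  ord_algebraMap : ∀ P, ∀ c : ℂ, c ≠ 0 → ord P (algebraMap ℂ F c) = 0
  /-- every point admits a local uniformizer (the valuation is surjective) -/
  ord_uniformizer : ∀ P, ∃ f : F, f ≠ 0 ∧ ord P f = 1
  /-- a nonzero rational function has only finitely many zeros and poles -/
  ord_finite_support : ∀ f : F, f ≠ 0 → (Function.support fun P => ord P f).Finite
  /-- distinct points are separated by rational functions -/
  ord_separates : ∀ P Q : Point, P ≠ Q → ∃ f : F, f ≠ 0 ∧ 0 < ord P f ∧ ord Q f = 0

attribute [instance] PreCurve.fieldF PreCurve.algF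

namespace PreCurve

variable (C : PreCurve)

/-- Divisors on the curve. -/
abbrev Div := C.Point →₀ ℤ

/-- The divisor of a single point. -/
def pt (P : C.Point) : C.Div := Finsupp.single P 1

/-- The degree of a divisor. -/
def deg (D : C.Div) : ℤ := D.sum fun _ n => n

/-- The Riemann–Roch space `H⁰(C, O(D)) = {f ∈ F | div f + D ≥ 0} ∪ {0}`. -/
def H0 (D : C.Div) : Submodule ℂ C.F where
  carrier := {f : C.F | f = 0 ∨ ∀ P, 0 ≤ C.ord P f + D P}
  zero_mem' := Or.inl rfl
  add_mem' := by
    intro f g hf hg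
    rcases eq_or_ne f 0 with rfl | hf0
    · simpa using hg
    rcases eq_or_ne g 0 with rfl | hg0
    · simpa using hf
    rcases eq_or_ne (f + g) 0 with h0 | h0
    · exact Or.inl h0
    rcases hf with rfl | hf
    · exact absurd rfl hf0
    rcases hg with rfl | hg
    · exact absurd rfl hg0
    refine Or.inr fun P => ?_
    have hmin := C.ord_add P f g hf0 hg0 h0
    rcases le_total (C.ord P f) (C.ord P g) with hle | hle
    · rw [min_eq_left hle] at hmin
      have := hf P; omega
    · rw [min_eq_right hle] at hmin
      have := hg P; omega
  smul_mem' := by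
    intro c f hf
    rcases eq_or_ne c 0 with rfl | hc
    · exact Or.inl (zero_smul ℂ f)
    rcases hf with rfl | hf
    · exact Or.inl (smul_zero c)
    rcases eq_or_ne f 0 with rfl | hf0
    · exact Or.inl (smul_zero c)
    refine Or.inr fun P => ?_
    have hmap : (algebraMap ℂ C.F c) ≠ 0 := fun h =>
      hc ((algebraMap ℂ C.F).injective (by rw [h, map_zero]))
    have hsm : c • f = algebraMap ℂ C.F c * f := Algebra.smul_def c f
    rw [hsm, C.ord_mul P _ f hmap hf0, C.ord_algebraMap P c hc]
    simpa using hf P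

theorem mem_H0 {D : C.Div} {f : C.F} :
    f ∈ C.H0 D ↔ (f = 0 ∨ ∀ P, 0 ≤ C.ord P f + D P) := Iff.rfl

/-- `h⁰(D) = dim H⁰(C, O(D))`. -/
def h0 (D : C.Div) : ℕ := Module.finrank ℂ (C.H0 D)

theorem H0_mono {D E : C.Div} (h : ∀ P, D P ≤ E P) : C.H0 D ≤ C.H0 E := by
  intro f hf
  rcases (C.mem_H0.mp hf) with rfl | hf
  · exact (C.H0 E).zero_mem
  · exact C.mem_H0.mpr (Or.inr fun P => by have := h P; have := hf P; omega)

theorem mul_mem_H0 {D E : C.Div} {f g : C.F} (hf : f ∈ C.H0 D) (hg : g ∈ C.H0 E) :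
    f * g ∈ C.H0 (D + E) := by
  rcases (C.mem_H0.mp hf) with rfl | hf
  · exact C.mem_H0.mpr (Or.inl (zero_mul g))
  rcases (C.mem_H0.mp hg) with rfl | hg
  · exact C.mem_H0.mpr (Or.inl (mul_zero f))
  rcases eq_or_ne f 0 with rfl | hf0
  · exact C.mem_H0.mpr (Or.inl (zero_mul g))
  rcases eq_or_ne g 0 with rfl | hg0
  · exact C.mem_H0.mpr (Or.inl (mul_zero f))
  refine C.mem_H0.mpr (Or.inr fun P => ?_)
  rw [C.ord_mul P f g hf0 hg0, Finsupp.add_apply]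
  have := hf P; have := hg P; omega

/-- Multiplication of sections, `H⁰(D) ⊗ H⁰(E) → H⁰(D + E)`, as a bilinear map. -/
def mulH0 (D E : C.Div) : C.H0 D →ₗ[ℂ] C.H0 E →ₗ[ℂ] C.H0 (D + E) :=
  LinearMap.mk₂ ℂ (fun f g => ⟨(f : C.F) * (g : C.F), C.mul_mem_H0 f.2 g.2⟩)
    (fun f f' g => Subtype.ext (by simp [add_mul]))
    (fun c f g => Subtype.ext (by simp [smul_mul_assoc]))
    (fun f g g' => Subtype.ext (by simp [mul_add]))
    (fun c f g => Subtype.ext (by simp [mul_smul_comm]))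

/-- Transport of `H⁰` along an equality of divisors. -/
def castH0 {D E : C.Div} (h : D = E) : (C.H0 D : Type) ≃ₗ[ℂ] C.H0 E :=
  LinearEquiv.ofEq _ _ (by rw [h])

/-- The multiplication map `H⁰(D) ⊗ H⁰(E) → H⁰(G)` for `G = D + E`. -/
def mulTo (D E G : C.Div) (h : D + E = G) : (C.H0 D ⊗[ℂ] C.H0 E) →ₗ[ℂ] C.H0 G :=
  (C.castH0 h).toLinearMap ∘ₗ TensorProduct.lift (C.mulH0 D E)

/-- The inclusion `H⁰(D) ⊆ H⁰(E)` for `D ≤ E`. -/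
def inclH0 {D E : C.Div} (h : ∀ P, D P ≤ E P) : (C.H0 D : Type) →ₗ[ℂ] C.H0 E :=
  Submodule.inclusion (C.H0_mono h)

/-- Multiplication by a fixed section `a ∈ H⁰(E)`, as a map `H⁰(M) → H⁰(E + M)`. -/
def mulBy {E : C.Div} (a : C.F) (ha : a ∈ C.H0 E) (M : C.Div) :
    (C.H0 M : Type) →ₗ[ℂ] C.H0 (E + M) :=
  C.mulH0 E M ⟨a, ha⟩

/-- The reduced effective divisor attached to a finite set of points. -/
def divOfFinset (s : Finset C.Point) : C.Div := ∑ P ∈ s, C.pt P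

/-- The divisor of a nonzero rational function. -/
def divOf (f : C.F) : C.Div := by
  classical
  exact if h : f = 0 then 0
    else Finsupp.ofSupportFinite (fun P => C.ord P f) (C.ord_finite_support f h)

/-- Linear equivalence of divisors. -/
def LinEquiv (D E : C.Div) : Prop := ∃ f : C.F, f ≠ 0 ∧ D - E = C.divOf f

end PreCurve

/-- A smooth connected projective complex curve: the data of `PreCurve` together with
properness (principal divisors have degree zero), finite–dimensionality of Riemann–Roch
spaces, `H⁰(O) = ℂ`, a canonical divisor `K`, and the genus, tied together by the
Riemann–Roch theorem (in its Serre-duality form `h⁰(D) − h⁰(K−D) = deg D + 1 − g`). -/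
structure Curve extends PreCurve where
  deg_principal : ∀ f : toPreCurve.F, f ≠ 0 → (∑ᶠ P, toPreCurve.ord P f) = 0
  finiteDim : ∀ D : toPreCurve.Div, FiniteDimensional ℂ (toPreCurve.H0 D)
  h0_triv : toPreCurve.h0 0 = 1
  /-- a canonical divisor (class) of the curve -/
  K : toPreCurve.Div
  /-- the genus of the curve -/
  genus : ℕ
  riemann_roch : ∀ D : toPreCurve.Div,
    (toPreCurve.h0 D : ℤ) - toPreCurve.h0 (K - D) = toPreCurve.deg D + 1 - genus

namespace Curve

variable (C : Curve)

/-- `h¹(D)`, via Serre duality. -/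
def h1 (D : C.Div) : ℕ := C.h0 (C.K - D)

/-- The complete linear system `|D|` is base-point free. -/
def BasePointFree (D : C.Div) : Prop := ∀ P : C.Point, C.h0 (D - C.pt P) + 1 = C.h0 D

/-- `|D|` is a base-point-free pencil (base-point free of projective dimension 1). -/
def IsBPFPencil (D : C.Div) : Prop := C.BasePointFree D ∧ C.h0 D = 2

/-- `C` is hyperelliptic: it carries a `g¹₂`. -/
def Hyperelliptic : Prop := ∃ D : C.Div, C.deg D = 2 ∧ 2 ≤ C.h0 D

/-- `C` is trigonal: it admits a degree-3 map to `ℙ¹`. -/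
def Trigonal : Prop := ∃ D : C.Div, C.deg D = 3 ∧ 2 ≤ C.h0 D ∧ C.BasePointFree D

/-- `D` is very ample (it separates points and tangent vectors). -/
def VeryAmple (D : C.Div) : Prop :=
  ∀ P Q : C.Point, C.h0 (D - C.pt P - C.pt Q) + 2 = C.h0 D

/-- `C` is a smooth plane quintic: it carries a very ample `g²₅`. -/
def IsPlaneQuintic : Prop := ∃ D : C.Div, C.deg D = 5 ∧ C.h0 D = 3 ∧ C.VeryAmple D

/-- The homogeneous coordinate algebra `R_L = ⊕ₙ H⁰(C, Lⁿ)` of a divisor (class) `L`,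
as a graded system inside the function field. -/
def RL (L : C.Div) : GradedSystem ℂ C.F where
  piece n := C.H0 (n • L)
  one_mem := by
    refine C.mem_H0.mpr (Or.inr fun P => ?_)
    have h1 : C.ord P 1 = 0 := by
      simpa using C.ord_algebraMap P 1 one_ne_zero
    simp [h1]
  mul_mem := by
    intro m n x y hx hy
    have h := C.mul_mem_H0 hx hy
    show x * y ∈ C.H0 ((m + n) • L)
    rwa [add_smul]

/-- The embedding given by the complete linear system `|L|` is projectively normal:
`R_L` is generated in degree one (equivalently, `Symⁿ H⁰(L) → H⁰(Lⁿ)` is surjective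
for all `n`). -/
def ProjectivelyNormal (L : C.Div) : Prop :=
  ∀ n : ℕ, Surjective
    (C.mulTo L (n • L) ((n + 1) • L) ((add_comm L (n • L)).trans (succ_nsmul L n).symm))

end Curve

/-- The homology of a (two-step) complex `X → Y → Z` at `Y`. -/
def homol {X Y Z : Type} [AddCommGroup X] [AddCommGroup Y] [AddCommGroup Z]
    [Module ℂ X] [Module ℂ Y] [Module ℂ Z] (f : X →ₗ[ℂ] Y) (g : Y →ₗ[ℂ] Z) : Type :=
  ↥(LinearMap.ker g) ⧸ Submodule.comap (LinearMap.ker g).subtype (LinearMap.range f)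


/-! ### Modules with a linear resolution -/

namespace LinearRes

variable {k F : Type} [Field k] [Field F] [Algebra k F]

/-- The first syzygies of the family `b`, shifted down by one degree: vectors of elements of
`R (n + 1)` forming a linear relation between the members of `b`. -/
def syz (R : ℕ → Submodule k F) {X ι : Type} [AddCommGroup X] [Module k X] [Module F X]
    [IsScalarTower k F X] [Fintype ι] (b : ι → X) (n : ℕ) : Submodule k (ι → F) where
  carrier := {v | (∀ j, v j ∈ R (n + 1)) ∧ ∑ j, v j • b j = 0}
  zero_mem' := ⟨fun _ => (R (n + 1)).zero_mem, by simp⟩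
  add_mem' := fun hv hw => ⟨fun j => (R (n + 1)).add_mem (hv.1 j) (hw.1 j), by
    simp only [Pi.add_apply, add_smul, Finset.sum_add_distrib, hv.2, hw.2, add_zero]⟩
  smul_mem' := fun c v hv => ⟨fun j => (R (n + 1)).smul_mem c (hv.1 j), by
    simp only [Pi.smul_apply, smul_assoc, ← Finset.smul_sum, hv.2, smul_zero]⟩

theorem mem_syz {R : ℕ → Submodule k F} {X ι : Type} [AddCommGroup X] [Module k X] [Module F X]
    [IsScalarTower k F X] [Fintype ι] {b : ι → X} {n : ℕ} {v : ι → F} :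
    v ∈ syz R b n ↔ (∀ j, v j ∈ R (n + 1)) ∧ ∑ j, v j • b j = 0 := Iff.rfl

/-- `b` is a linearly independent family in degree `0` generating the graded module `M`. -/
structure IsGenerating (R : ℕ → Submodule k F) {X ι : Type} [AddCommGroup X] [Module k X]
    [Module F X] [Fintype ι] (M : ℕ → Submodule k X) (b : ι → X) : Prop where
  indep : LinearIndependent k b
  mem : ∀ j, b j ∈ M 0
  gen : ∀ n, ∀ x ∈ M n, ∃ v : ι → F, (∀ j, v j ∈ R n) ∧ ∑ j, v j • b j = x

/-- The graded `R`-module `M` is generated in degree `0` and its first `i - 1` syzygy modules are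
generated in the lowest possible degree. -/
def IsLin (R : ℕ → Submodule k F) : ℕ → ∀ (X : Type) [AddCommGroup X] [Module k X] [Module F X]
    [IsScalarTower k F X], (ℕ → Submodule k X) → Prop
  | 0, _, _, _, _, _, _ => True
  | i + 1, _, _, _, _, _, M => ∃ (ι : Type) (_ : Fintype ι) (b : ι → _),
      IsGenerating R M b ∧ IsLin R i (ι → F) (syz R b)

variable {R : ℕ → Submodule k F} {X X' X'' : Type}
  [AddCommGroup X] [Module k X] [Module F X] [IsScalarTower k F X]
  [AddCommGroup X'] [Module k X'] [Module F X'] [IsScalarTower k F X']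
  [AddCommGroup X''] [Module k X''] [Module F X''] [IsScalarTower k F X'']

theorem IsLin.of_succ {i : ℕ} : ∀ {X : Type} [AddCommGroup X] [Module k X] [Module F X]
    [IsScalarTower k F X] {M : ℕ → Submodule k X}, IsLin R (i + 1) X M → IsLin R i X M := by
  induction i with
  | zero => intros; trivial
  | succ i ih =>
    rintro X _ _ _ _ M ⟨ι, _, b, hb, h⟩
    exact ⟨ι, _, b, hb, ih h⟩

theorem IsLin.map {i : ℕ} {M' : ℕ → Submodule k X'} {M : ℕ → Submodule k X} (α : X' →ₗ[F] X)
    (hα : Injective α) (hM : ∀ n x, x ∈ M n ↔ ∃ y ∈ M' n, α y = x) (h : IsLin R i X' M') :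
    IsLin R i X M := by
  cases i with
  | zero => trivial
  | succ i =>
    obtain ⟨ι, _, b, hb, h⟩ := h
    refine ⟨ι, _, fun j => α (b j), ⟨?_, fun j => (hM _ _).2 ⟨_, hb.mem j, rfl⟩, ?_⟩, ?_⟩
    · exact hb.indep.map' (α.restrictScalars k) (LinearMap.ker_eq_bot.2 hα)
    · intro n x hx
      obtain ⟨y, hy, rfl⟩ := (hM _ _).1 hx
      obtain ⟨v, hv, rfl⟩ := hb.gen n y hy
      exact ⟨v, hv, by simp⟩
    · convert h using 2
      funext n
      ext v
      have : ∑ j, v j • α (b j) = α (∑ j, v j • b j) := by simp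
      rw [mem_syz, mem_syz, this, map_eq_zero_iff α hα]

/-- Extension by zero, as an `F`-linear map. -/
def inlMap (F : Type) [Field F] (ι κ : Type) : (ι → F) →ₗ[F] (ι ⊕ κ → F) where
  toFun v := Sum.elim v 0
  map_add' _ _ := by ext (j | j) <;> simp
  map_smul' _ _ := by ext (j | j) <;> simp

theorem inlMap_injective (ι κ : Type) : Injective (inlMap F ι κ) := fun _ _ h =>
  funext fun j => congrFun h (Sum.inl j)

theorem isLin_of_exact (hR : ∀ m n r s, r ∈ R m → s ∈ R n → r * s ∈ R (m + n)) {i : ℕ} :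
    ∀ {X X' X'' : Type}
      [AddCommGroup X] [Module k X] [Module F X] [IsScalarTower k F X]
      [AddCommGroup X'] [Module k X'] [Module F X'] [IsScalarTower k F X']
      [AddCommGroup X''] [Module k X''] [Module F X''] [IsScalarTower k F X'']
      {M : ℕ → Submodule k X} {M' : ℕ → Submodule k X'} {M'' : ℕ → Submodule k X''}
      (α : X' →ₗ[F] X) (β : X →ₗ[F] X''), Injective α →
      (∀ n r x, r ∈ R n → x ∈ M 0 → r • x ∈ M n) →
      (∀ n, ∀ x ∈ M' n, α x ∈ M n) →
      (∀ n, ∀ x ∈ M' n, β (α x) = 0) →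
      (∀ n, ∀ x ∈ M n, β x ∈ M'' n) →
      (∀ n, ∀ x ∈ M n, β x = 0 → ∃ y ∈ M' n, α y = x) →
      (∀ n, ∀ z ∈ M'' n, ∃ x ∈ M n, β x = z) →
      IsLin R i X' M' → IsLin R i X'' M'' → IsLin R i X M := by
  induction i with
  | zero => intros; trivial
  | succ i ih =>
    rintro X X' X'' _ _ _ _ _ _ _ _ _ _ _ _ M M' M'' α β hα hM h1 h2 h3 h4 h5
      ⟨ι, _, b, hb, h⟩ ⟨κ, _, c, hc, h'⟩
    choose l hl hlc using fun j => h5 0 (c j) (hc.mem j)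
    have hsum : ∀ v : ι ⊕ κ → F, ∑ j, v j • Sum.elim (fun j => α (b j)) l j
        = α (∑ j, v (Sum.inl j) • b j) + ∑ j, v (Sum.inr j) • l j := fun v => by
      simp [Fintype.sum_sum_type]
    have hα0 : ∀ v : ι → F, β (α (∑ j, v j • b j)) = 0 := fun v => by
      simp only [map_sum, map_smul, h2 0 _ (hb.mem _), smul_zero, Finset.sum_const_zero]
    refine ⟨ι ⊕ κ, inferInstance, Sum.elim (fun j => α (b j)) l, ⟨?_, ?_, ?_⟩, ?_⟩
    · rw [Fintype.linearIndependent_iff]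
      intro v hv
      have hv' := hsum fun j => algebraMap k F (v j)
      simp only [algebraMap_smul] at hv'
      rw [hv] at hv'
      have h6 := congrArg β hv'
      rw [map_add] at h6
      have h7 := hα0 fun j => algebraMap k F (v (Sum.inl j))
      simp only [algebraMap_smul] at h7
      rw [h7, map_zero, zero_add, map_sum] at h6
      simp only [LinearMap.map_smul_of_tower, hlc] at h6
      have h8 := Fintype.linearIndependent_iff.1 hc.indep _ h6.symm
      simp only [h8, zero_smul, Finset.sum_const_zero, add_zero] at hv'
      have h9 := Fintype.linearIndependent_iff.1 hb.indep _
        ((map_eq_zero_iff α hα).1 hv'.symm)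
      rintro (j | j)
      exacts [h9 j, h8 j]
    · rintro (j | j)
      exacts [h1 _ _ (hb.mem j), hl j]
    · intro n x hx
      obtain ⟨w, hw, hwx⟩ := hc.gen n _ (h3 n x hx)
      have hy : ∑ j, w j • l j ∈ M n := Submodule.sum_mem _ fun j _ => hM _ _ _ (hw j) (hl j)
      obtain ⟨y, hy, hyx⟩ := h4 n _ ((M n).sub_mem hx hy) (by simp [hlc, hwx])
      obtain ⟨v, hv, rfl⟩ := hb.gen n y hy
      refine ⟨Sum.elim v w, ?_, ?_⟩
      · rintro (j | j)
        exacts [hv j, hw j]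
      · rw [hsum]
        simp only [Sum.elim_inl, Sum.elim_inr, hyx, sub_add_cancel]
    · refine ih (inlMap F ι κ) (LinearMap.funLeft F F Sum.inr) (inlMap_injective ι κ)
        ?_ ?_ ?_ ?_ ?_ ?_ h h'
      · intro n r v hr hv
        refine ⟨fun j => ?_, ?_⟩
        · have := hR _ _ _ _ hr (hv.1 j)
          simpa using this
        · simp only [Pi.smul_apply, smul_assoc, ← Finset.smul_sum, hv.2, smul_zero]
      · intro n v hv
        refine ⟨?_, ?_⟩
        · rintro (j | j)
          exacts [hv.1 j, (R _).zero_mem]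
        · rw [hsum]
          simp [inlMap, hv.2]
      · intro n v hv
        ext j
        simp [inlMap, LinearMap.funLeft]
      · intro n v hv
        refine ⟨fun j => hv.1 _, ?_⟩
        have := congrArg β (hsum v)
        rw [hv.2, map_zero, map_add, hα0 fun j => v (Sum.inl j)] at this
        simpa [hlc, LinearMap.funLeft] using this.symm
      · intro n v hv hv0
        have hv0' : ∀ j, v (Sum.inr j) = 0 := fun j => congrFun hv0 j
        refine ⟨fun j => v (Sum.inl j), ⟨fun j => hv.1 _, ?_⟩, ?_⟩
        · have := hsum v
          rw [hv.2] at this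
          simp only [hv0', zero_smul, Finset.sum_const_zero, add_zero] at this
          exact (map_eq_zero_iff α hα).1 this.symm
        · ext (j | j)
          · rfl
          · exact (hv0' j).symm
      · intro n w hw
        have hy : ∑ j, w j • l j ∈ M (n + 1) :=
          Submodule.sum_mem _ fun j _ => hM _ _ _ (hw.1 j) (hl j)
        obtain ⟨y, hy, hyx⟩ := h4 _ _ hy (by simpa [hlc] using hw.2)
        obtain ⟨v, hv, rfl⟩ := hb.gen _ y hy
        refine ⟨Sum.elim (-v) w, ⟨?_, ?_⟩, ?_⟩
        · rintro (j | j)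
          exacts [(R _).neg_mem (hv j), hw.1 j]
        · rw [hsum]
          simp [← hyx]
        · ext j
          simp [LinearMap.funLeft]

/-- If `M` is obtained from `N` by adding one generator `f` of degree zero, and the annihilator
of `f` modulo `N` is `T` (shifted by one), linearity of `M` follows from that of `N` and `T`. -/
theorem isLin_of_adjoin (hR : ∀ m n r s, r ∈ R m → s ∈ R n → r * s ∈ R (m + n)) {i : ℕ}
    {N M : ℕ → Submodule k X} {T : ℕ → Submodule k F} (f : X) (hf : f ∈ M 0) (hfN : f ∉ N 0)
    (hNM : ∀ n, N n ≤ M n) (hNR : ∀ n r x, r ∈ R n → x ∈ N 0 → r • x ∈ N n)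
    (hM : ∀ n, ∀ x ∈ M n, ∃ r ∈ R n, x - r • f ∈ N n)
    (hT : ∀ n r, r ∈ T n ↔ r ∈ R (n + 1) ∧ r • f ∈ N (n + 1))
    (hN : IsLin R (i + 1) X N) (hTl : IsLin R i F T) : IsLin R (i + 1) X M := by
  obtain ⟨ι, _, b, hb, h⟩ := hN
  have hsum : ∀ v : ι ⊕ Unit → F, ∑ j, v j • Sum.elim b (fun _ => f) j
      = ∑ j, v (Sum.inl j) • b j + v (Sum.inr ()) • f := fun v => by
    simp [Fintype.sum_sum_type]
  refine ⟨ι ⊕ Unit, inferInstance, Sum.elim b fun _ => f, ⟨?_, ?_, ?_⟩, ?_⟩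
  · rw [Fintype.linearIndependent_iff]
    intro v hv
    have hv' := hsum fun j => algebraMap k F (v j)
    simp only [algebraMap_smul] at hv'
    rw [hv] at hv'
    have h0 : v (Sum.inr ()) = 0 := by
      by_contra hne
      refine hfN ?_
      have h1 : f = (-(v (Sum.inr ()))⁻¹) • ∑ j, v (Sum.inl j) • b j := by
        rw [eq_neg_of_add_eq_zero_left hv'.symm, smul_neg, neg_smul, neg_neg, smul_smul,
          inv_mul_cancel₀ hne, one_smul]
      rw [h1]
      exact (N 0).smul_mem _ (Submodule.sum_mem _ fun j _ => (N 0).smul_mem _ (hb.mem j))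
    rw [h0, zero_smul, add_zero] at hv'
    have h9 := Fintype.linearIndependent_iff.1 hb.indep _ hv'.symm
    rintro (j | j)
    exacts [h9 j, h0]
  · rintro (j | j)
    exacts [hNM _ (hb.mem j), hf]
  · intro n x hx
    obtain ⟨r, hr, hrx⟩ := hM n x hx
    obtain ⟨v, hv, hvx⟩ := hb.gen n _ hrx
    refine ⟨Sum.elim v fun _ => r, ?_, ?_⟩
    · rintro (j | j)
      exacts [hv j, hr]
    · rw [hsum]
      simp [hvx]
  · refine isLin_of_exact hR (inlMap F ι Unit) (LinearMap.proj (Sum.inr ()))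
      (inlMap_injective ι Unit) ?_ ?_ ?_ ?_ ?_ ?_ h hTl
    · intro n r v hr hv
      refine ⟨fun j => ?_, ?_⟩
      · have := hR _ _ _ _ hr (hv.1 j)
        simpa using this
      · simp only [Pi.smul_apply, smul_assoc, ← Finset.smul_sum, hv.2, smul_zero]
    · intro n v hv
      refine ⟨?_, ?_⟩
      · rintro (j | j)
        exacts [hv.1 j, (R _).zero_mem]
      · rw [hsum]
        simp [inlMap, hv.2]
    · intro n v hv
      simp [inlMap]
    · intro n v hv
      refine (hT _ _).2 ⟨hv.1 _, ?_⟩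
      have h1 := hsum v
      rw [hv.2] at h1
      have h2 : v (Sum.inr ()) • f = -∑ j, v (Sum.inl j) • b j :=
        eq_neg_of_add_eq_zero_right h1.symm
      rw [LinearMap.proj_apply, h2]
      exact (N _).neg_mem (Submodule.sum_mem _ fun j _ => hNR _ _ _ (hv.1 _) (hb.mem j))
    · intro n v hv hv0
      have hv0' : v (Sum.inr ()) = 0 := hv0
      refine ⟨fun j => v (Sum.inl j), ⟨fun j => hv.1 _, ?_⟩, ?_⟩
      · have := hsum v
        rw [hv.2, hv0', zero_smul, add_zero] at this
        exact this.symm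
      · ext (j | j)
        · rfl
        · exact hv0'.symm
    · intro n r hr
      obtain ⟨hr, hrf⟩ := (hT _ _).1 hr
      obtain ⟨v, hv, hvx⟩ := hb.gen _ _ hrf
      refine ⟨Sum.elim (-v) fun _ => r, ⟨?_, ?_⟩, rfl⟩
      · rintro (j | j)
        exacts [(R _).neg_mem (hv j), hr]
      · rw [hsum]
        simp [hvx]

/-- The linearity of the syzygies does not depend on the choice of generators. -/
theorem IsLin.syz_of_isGenerating {i : ℕ} {M : ℕ → Submodule k X} {ι : Type} [Fintype ι]
    {b : ι → X} (hb : IsGenerating R M b) (hR0 : R 0 = Submodule.span k {1})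
    (h : IsLin R (i + 1) X M) : IsLin R i (ι → F) (syz R b) := by
  obtain ⟨κ, _, c, hc, h⟩ := h
  have key : ∀ {ι κ : Type} [Fintype ι] [Fintype κ] {b : ι → X} {c : κ → X},
      IsGenerating R M b → IsGenerating R M c →
      ∃ a : ι → κ → k, ∀ j, ∑ l, a j l • c l = b j := by
    intro ι κ _ _ b c hb hc
    have : ∀ j, ∃ a : κ → k, ∑ l, a l • c l = b j := by
      intro j
      obtain ⟨v, hv, hvx⟩ := hc.gen 0 _ (hb.mem j)
      simp only [hR0, Submodule.mem_span_singleton] at hv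
      choose a ha using hv
      refine ⟨a, ?_⟩
      rw [← hvx]
      refine Finset.sum_congr rfl fun l _ => ?_
      rw [← ha l, smul_assoc, one_smul]
    choose a ha using this
    exact ⟨a, ha⟩
  obtain ⟨p, hp⟩ := key hb hc
  obtain ⟨q, hq⟩ := key hc hb
  have comp : ∀ {ι κ : Type} [Fintype ι] [Fintype κ] {b : ι → X} {c : κ → X}
      (p : ι → κ → k) (q : κ → ι → k), LinearIndependent k b →
      (∀ j, ∑ l, p j l • c l = b j) → (∀ j, ∑ l, q j l • b l = c j) → 
      ∀ v : ι → F, (fun m => ∑ l, q l m • ∑ j, p j l • v j) = v := by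
    intro ι κ _ _ b c p q hb hp hq v
    classical
    have h1 : ∀ j m, ∑ l, p j l * q l m = if j = m then 1 else 0 := by
      intro j m
      have h2 : ∑ m, (∑ l, p j l * q l m - if j = m then 1 else 0) • b m = 0 := by
        simp only [sub_smul, Finset.sum_sub_distrib, Finset.sum_smul, ite_smul, one_smul, zero_smul,
          Finset.sum_ite_eq, Finset.mem_univ, if_true]
        rw [Finset.sum_comm]
        simp only [mul_smul, ← Finset.smul_sum, hq, hp, sub_self]
      exact sub_eq_zero.1 (Fintype.linearIndependent_iff.1 hb _ h2 m)
    funext m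
    simp only [Finset.smul_sum, smul_smul]
    rw [Finset.sum_comm]
    simp only [← Finset.sum_smul, mul_comm (q _ _), h1]
    simp
  have tr : ∀ {ι κ : Type} [Fintype ι] [Fintype κ] {b : ι → X} {c : κ → X}
      (p : ι → κ → k), (∀ j, ∑ l, p j l • c l = b j) → ∀ n, ∀ v ∈ syz R b n,
      (fun l => ∑ j, p j l • v j) ∈ syz R c n := by
    intro ι κ _ _ b c p hp n v hv
    refine ⟨fun l => Submodule.sum_mem _ fun j _ => (R _).smul_mem _ (hv.1 j), ?_⟩
    rw [← hv.2]
    simp only [← hp, Finset.sum_smul, Finset.smul_sum]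
    rw [Finset.sum_comm]
    refine Finset.sum_congr rfl fun j _ => Finset.sum_congr rfl fun l _ => ?_
    rw [smul_assoc, smul_comm]
  let α : (κ → F) →ₗ[F] (ι → F) :=
    { toFun := fun v m => ∑ l, q l m • v l
      map_add' := fun v w => by ext m; simp [Finset.sum_add_distrib]
      map_smul' := fun r v => by ext m; simp [Finset.mul_sum] }
  refine h.map α ?_ fun n x => ⟨fun hx => ⟨_, tr p hp n x hx, comp p q hb.indep hp hq x⟩, ?_⟩
  · intro v w hvw
    rw [← comp q p hc.indep hq hp v, ← comp q p hc.indep hq hp w]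
    have : ∀ m, ∑ l, q l m • v l = ∑ l, q l m • w l := fun m => congrFun hvw m
    simp only [this]
  · rintro ⟨y, hy, rfl⟩
    exact tr q hq n y hy

end LinearRes

/-! ### Koszulness from linear syzygies -/

namespace LinearRes

variable {k F : Type} [Field k] [Field F] [Algebra k F]

/-- A step in the construction of a linear resolution: a graded submodule of a free module all of
whose syzygies are linear. -/
structure Stage (R : ℕ → Submodule k F) where
  rank : ℕ
  M : ℕ → Submodule k (Fin rank → F)
  lin : ∀ i, IsLin R i (Fin rank → F) M

theorem Stage.exists_isGenerating {R : ℕ → Submodule k F} (s : Stage R) :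
    ∃ (m : ℕ) (b : Fin m → Fin s.rank → F), IsGenerating R s.M b := by
  obtain ⟨ι, _, b, hb, -⟩ := s.lin 1
  let e := Fintype.equivFin ι
  refine ⟨Fintype.card ι, b ∘ e.symm, hb.indep.comp _ e.symm.injective, fun j => hb.mem _, ?_⟩
  intro n x hx
  obtain ⟨v, hv, rfl⟩ := hb.gen n x hx
  refine ⟨v ∘ e.symm, fun j => hv _, ?_⟩
  exact e.symm.sum_comp fun j => v j • b j

/-- The first syzygy module of a stage, for some choice of generators. -/
def Stage.next {R : ℕ → Submodule k F} (hR0 : R 0 = Submodule.span k {1}) (s : Stage R) :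
    Stage R where
  rank := s.exists_isGenerating.choose
  M := syz R s.exists_isGenerating.choose_spec.choose
  lin i := (s.lin (i + 1)).syz_of_isGenerating s.exists_isGenerating.choose_spec.choose_spec hR0

/-- The vectors of length `m` with entries in `R (n + 1)`. -/
def pos (R : ℕ → Submodule k F) (m n : ℕ) : Submodule k (Fin m → F) where
  carrier := {v | ∀ j, v j ∈ R (n + 1)}
  zero_mem' := fun _ => (R (n + 1)).zero_mem
  add_mem' := fun hv hw j => (R (n + 1)).add_mem (hv j) (hw j)
  smul_mem' := fun c _ hv j => (R (n + 1)).smul_mem c (hv j)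

theorem exists_matrices {R : ℕ → Submodule k F} (hR0 : R 0 = Submodule.span k {1})
    (h : ∀ i, IsLin R i F fun n => R (n + 1)) :
    ∃ (n : ℕ → ℕ) (b : ∀ i, Fin (n (i + 1)) → Fin (n i) → F), n 0 = 1 ∧
      IsGenerating R (pos R (n 0)) (b 0) ∧ ∀ i, IsGenerating R (syz R (b i)) (b (i + 1)) := by
  let s0 : Stage R := ⟨1, pos R 1, fun i => (h i).map (LinearMap.pi fun _ => LinearMap.id)
    (fun x y hxy => congrFun hxy 0) fun n x => ⟨fun hx => ⟨x 0, hx 0, by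
      ext j; fin_cases j; rfl⟩, by rintro ⟨y, hy, rfl⟩ j; exact hy⟩⟩
  let s : ℕ → Stage R := fun i => Nat.rec s0 (fun _ t => t.next hR0) i
  exact ⟨fun i => (s i).rank, fun i => (s i).exists_isGenerating.choose_spec.choose, rfl,
    s0.exists_isGenerating.choose_spec.choose_spec, fun i =>
    (s (i + 1)).exists_isGenerating.choose_spec.choose_spec⟩

variable (S : GradedSystem k F)

/-- Tensors as vectors with entries in a graded component. -/
def coordEquiv (m d : ℕ) : ((Fin m → k) ⊗[k] S.piece d) ≃ₗ[k] (Fin m → S.piece d) :=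
  (TensorProduct.comm k _ _).trans (TensorProduct.piScalarRight k k (S.piece d) (Fin m))

/-- Tensors as vectors with entries in the ambient field. -/
def coord (m d : ℕ) : ((Fin m → k) ⊗[k] S.piece d) →ₗ[k] (Fin m → F) :=
  (LinearMap.pi fun l => (S.piece d).subtype ∘ₗ LinearMap.proj l) ∘ₗ
    (coordEquiv S m d).toLinearMap

theorem coord_apply (m d : ℕ) (t : (Fin m → k) ⊗[k] S.piece d) (l : Fin m) :
    coord S m d t l = (coordEquiv S m d t l : F) := rfl

theorem coord_tmul (m d : ℕ) (w : Fin m → k) (r : S.piece d) (l : Fin m) :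
    coord S m d (w ⊗ₜ r) l = w l • (r : F) := by
  simp [coord_apply, coordEquiv]

theorem coord_injective (m d : ℕ) : Injective (coord S m d) := fun _ _ h =>
  (coordEquiv S m d).injective (funext fun l => Subtype.ext (congrFun h l))

theorem exists_coord_eq {m d : ℕ} {v : Fin m → F} (hv : ∀ l, v l ∈ S.piece d) :
    ∃ t, coord S m d t = v :=
  ⟨(coordEquiv S m d).symm fun l => ⟨v l, hv l⟩, by ext l; simp [coord_apply]⟩

theorem coord_mem (m d : ℕ) (t : (Fin m → k) ⊗[k] S.piece d) (l : Fin m) :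
    coord S m d t l ∈ S.piece d := (coordEquiv S m d t l).2

/-- The map of free modules with matrix `b`, restricted to generators. -/
def matrixMap {m' m : ℕ} (b : Fin m' → Fin m → F) (hb : ∀ j l, b j l ∈ S.piece 1) :
    (Fin m' → k) →ₗ[k] ((Fin m → k) ⊗[k] S.piece 1) :=
  Fintype.linearCombination k fun j => (coordEquiv S m 1).symm fun l => ⟨b j l, hb j l⟩

theorem coord_matrixMap {m' m : ℕ} (b : Fin m' → Fin m → F) (hb : ∀ j l, b j l ∈ S.piece 1)
    (w : Fin m' → k) : coord S m 1 (matrixMap S b hb w) = ∑ j, w j • b j := by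
  rw [matrixMap, Fintype.linearCombination_apply, map_sum]
  refine Finset.sum_congr rfl fun j _ => ?_
  rw [map_smul]
  congr 1
  ext l
  simp [coord_apply]

theorem coord_Dmap (n : ℕ → ℕ) (b : ∀ i, Fin (n (i + 1)) → Fin (n i) → F)
    (hb : ∀ i j l, b i j l ∈ S.piece 1) (i d : ℕ)
    (t : (Fin (n (i + 1)) → k) ⊗[k] S.piece d) :
    coord S _ _ (S.Dmap n (fun i => matrixMap S (b i) (hb i)) i d t)
      = ∑ j, coord S _ _ t j • b i j := by
  have aux : ∀ (u : (Fin (n i) → k) ⊗[k] S.piece 1) (r : S.piece d),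
      coord S _ _ ((LinearMap.lTensor (Fin (n i) → k)
        ((S.cast (add_comm 1 d)).toLinearMap ∘ₗ TensorProduct.lift (S.mulMap 1 d)))
        ((TensorProduct.assoc k (Fin (n i) → k) (S.piece 1) (S.piece d)) (u ⊗ₜ r)))
        = (r : F) • coord S _ _ u := by
    intro u r
    induction u with
    | zero => simp
    | add x y hx hy => rw [TensorProduct.add_tmul, map_add, map_add, map_add, hx, hy, map_add,
        smul_add]
    | tmul w x =>
      ext l
      simp only [TensorProduct.assoc_tmul, LinearMap.lTensor_tmul, coord_tmul, Pi.smul_apply]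
      simp [GradedSystem.mulMap, GradedSystem.cast, mul_comm]
  induction t with
  | zero => simp
  | add x y hx hy => simp only [map_add, hx, hy, Pi.add_apply, add_smul, Finset.sum_add_distrib]
  | tmul w r =>
    have := aux (matrixMap S (b i) (hb i) w) r
    rw [coord_matrixMap] at this
    simp only [GradedSystem.Dmap, LinearMap.comp_apply, LinearMap.rTensor_tmul]
    refine this.trans ?_
    simp only [Finset.smul_sum, coord_tmul]
    refine Finset.sum_congr rfl fun j _ => ?_
    rw [smul_comm, smul_assoc]

theorem isKoszul_of_isLin (h0 : S.ConnectedOne)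
    (h : ∀ i, IsLin S.piece i F fun n => S.piece (n + 1)) : S.IsKoszul := by
  obtain ⟨n, b, hn, hb0, hbs⟩ := exists_matrices h0 h
  have hb : ∀ i j l, b i j l ∈ S.piece 1 := by
    rintro (_ | i) j l
    · exact hb0.mem j l
    · exact ((hbs i).mem j).1 l
  have hind : ∀ i, LinearIndependent k (b i) := by
    rintro (_ | i)
    exacts [hb0.indep, (hbs i).indep]
  have hone : S.piece 0 = Submodule.span k {(1 : F)} := h0
  refine ⟨h0, n, fun i => matrixMap S (b i) (hb i), hn, ?_, ?_, ?_⟩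
  · intro d y
    obtain ⟨v, hv, hvy⟩ := hb0.gen d (coord S _ _ y) (coord_mem S _ _ y)
    obtain ⟨t, rfl⟩ := exists_coord_eq S hv
    exact ⟨t, coord_injective S _ _ (by rw [coord_Dmap, hvy])⟩
  · intro i
    rw [← LinearMap.ker_eq_bot, LinearMap.ker_eq_bot']
    intro t ht
    have h1 := coord_Dmap S n b hb i 0 t
    rw [ht, map_zero] at h1
    have h2 := coord_mem S _ _ t
    simp only [hone, Submodule.mem_span_singleton] at h2
    choose a ha using h2
    simp only [← ha, smul_assoc, one_smul] at h1
    have h3 := Fintype.linearIndependent_iff.1 (hind i) a h1.symm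
    refine coord_injective S _ _ (funext fun l => ?_)
    rw [← ha, h3, zero_smul, map_zero, Pi.zero_apply]
  · intro i d
    ext t
    rw [LinearMap.mem_range, LinearMap.mem_ker]
    constructor
    · rintro ⟨u, rfl⟩
      refine coord_injective S _ _ ?_
      rw [coord_Dmap, coord_Dmap, map_zero]
      simp only [Finset.sum_apply, Pi.smul_apply, Finset.sum_smul]
      rw [Finset.sum_comm]
      refine Finset.sum_eq_zero fun j _ => ?_
      simp only [smul_assoc, ← Finset.smul_sum, ((hbs i).mem j).2, smul_zero]
    · intro ht
      have h1 := coord_Dmap S n b hb i (d + 1) t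
      rw [ht, map_zero] at h1
      obtain ⟨v, hv, hvt⟩ := (hbs i).gen d (coord S _ _ t) ⟨coord_mem S _ _ t, h1.symm⟩
      obtain ⟨u, rfl⟩ := exists_coord_eq S hv
      exact ⟨u, coord_injective S _ _ (by rw [coord_Dmap, hvt])⟩

end LinearRes

/-! ### Riemann–Roch spaces -/

namespace PreCurve

variable {C : PreCurve}

@[simp]
theorem deg_add (D E : C.Div) : C.deg (D + E) = C.deg D + C.deg E :=
  Finsupp.sum_add_index' (fun _ => rfl) fun _ _ _ => rfl

@[simp]
theorem deg_sub (D E : C.Div) : C.deg (D - E) = C.deg D - C.deg E := by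
  have := deg_add (D - E) E
  rw [sub_add_cancel] at this
  omega

@[simp]
theorem deg_pt (P : C.Point) : C.deg (C.pt P) = 1 := by simp [deg, pt]

@[simp]
theorem deg_zero : C.deg 0 = 0 := by simp [deg]

@[simp]
theorem deg_nsmul (n : ℕ) (D : C.Div) : C.deg (n • D) = n * C.deg D := by
  induction n with
  | zero => simp
  | succ n ih => rw [succ_nsmul, deg_add, ih]; push_cast; ring

theorem deg_sum_pt {ι : Type} (S : Finset ι) (P : ι → C.Point) :
    C.deg (∑ i ∈ S, C.pt (P i)) = S.card := by
  classical
  induction S using Finset.induction_on with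
  | empty => simp
  | insert i S hi ih =>
    rw [Finset.sum_insert hi, deg_add, Finset.card_insert_of_notMem hi, ih, deg_pt]
    push_cast
    ring

@[simp]
theorem deg_divOfFinset (s : Finset C.Point) : C.deg (C.divOfFinset s) = s.card :=
  deg_sum_pt s id

@[simp]
theorem pt_self (P : C.Point) : C.pt P P = 1 := by simp [pt]

theorem pt_of_ne {P Q : C.Point} (h : Q ≠ P) : C.pt P Q = 0 := by
  simp [pt, h.symm]

theorem pt_nonneg (P Q : C.Point) : 0 ≤ C.pt P Q := by
  rcases eq_or_ne Q P with rfl | h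
  · simp
  · rw [pt_of_ne h]

theorem H0_sub_pt_le (D : C.Div) (P : C.Point) : C.H0 (D - C.pt P) ≤ C.H0 D :=
  C.H0_mono fun Q => by have := pt_nonneg P Q; simp [this]

theorem mem_H0_iff {D : C.Div} {f : C.F} (hf : f ≠ 0) :
    f ∈ C.H0 D ↔ ∀ P, 0 ≤ C.ord P f + D P := by
  rw [mem_H0]; exact ⟨fun h => h.resolve_left hf, Or.inr⟩

theorem mem_H0_sub_pt {D : C.Div} {f : C.F} (hf : f ≠ 0) {P : C.Point} :
    f ∈ C.H0 (D - C.pt P) ↔ f ∈ C.H0 D ∧ C.ord P f + D P ≠ 0 := by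
  rw [mem_H0_iff hf, mem_H0_iff hf]
  constructor
  · intro h
    refine ⟨fun Q => ?_, ?_⟩
    · have := h Q; have := pt_nonneg P Q; simp at *; omega
    · have := h P; simp at this; omega
  · rintro ⟨h, h'⟩ Q
    have := h Q
    rcases eq_or_ne Q P with rfl | hQ
    · simp; omega
    · simp [pt_of_ne hQ]; omega

end PreCurve

namespace Curve

open PreCurve

variable {C : Curve}

instance (D : C.Div) : FiniteDimensional ℂ (C.H0 D) := C.finiteDim D

theorem h0_mono {D E : C.Div} (h : C.H0 D ≤ C.H0 E) : C.h0 D ≤ C.h0 E :=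
  Submodule.finrank_mono h

theorem h0_pos_iff {D : C.Div} : 0 < C.h0 D ↔ ∃ f ∈ C.H0 D, f ≠ 0 := by
  rw [h0, Module.finrank_pos_iff, Submodule.nontrivial_iff_ne_bot, Submodule.ne_bot_iff]

theorem h0_eq_zero_iff {D : C.Div} : C.h0 D = 0 ↔ ∀ f ∈ C.H0 D, f = 0 := by
  rw [h0, Submodule.finrank_eq_zero, Submodule.eq_bot_iff]

theorem h0_eq_zero_of_deg_neg {D : C.Div} (h : C.deg D < 0) : C.h0 D = 0 := by
  rw [h0_eq_zero_iff]
  intro f hf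
  by_contra hf0
  rw [mem_H0_iff hf0] at hf
  have hfin := C.ord_finite_support f hf0
  have h1 := C.deg_principal f hf0
  let d : C.Div := Finsupp.ofSupportFinite (fun P => C.ord P f) hfin
  have h2 : C.deg d = 0 := by
    rw [← h1, deg, Finsupp.sum, finsum_eq_sum_of_support_subset]
    · rfl
    · intro P hP
      rw [Finset.mem_coe, Finsupp.mem_support_iff]
      exact hP
  have h3 : 0 ≤ C.deg (d + D) := Finset.sum_nonneg fun P _ => hf P
  rw [deg_add] at h3
  omega

theorem h0_K : C.h0 C.K = C.genus := by
  have := C.riemann_roch 0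
  rw [sub_zero, C.h0_triv, deg_zero] at this
  omega

theorem deg_K : C.deg C.K = 2 * C.genus - 2 := by
  have := C.riemann_roch C.K
  rw [sub_self, C.h0_triv, h0_K] at this
  omega

theorem h1_eq_zero_of_deg {D : C.Div} (h : 2 * (C.genus : ℤ) - 2 < C.deg D) : C.h1 D = 0 :=
  h0_eq_zero_of_deg_neg (by rw [deg_sub, deg_K]; omega)

theorem h0_sub_h1 (D : C.Div) : (C.h0 D : ℤ) - C.h1 D = C.deg D + 1 - C.genus :=
  C.riemann_roch D

theorem h0_sub_pt_le (D : C.Div) (P : C.Point) : C.h0 (D - C.pt P) ≤ C.h0 D :=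
  h0_mono (H0_sub_pt_le D P)

theorem h0_le_h0_sub_pt (D : C.Div) (P : C.Point) : C.h0 D ≤ C.h0 (D - C.pt P) + 1 := by
  have h1 := C.riemann_roch D
  have h2 := C.riemann_roch (D - C.pt P)
  have h3 := h0_sub_pt_le (C.K - (D - C.pt P)) P
  rw [show C.K - (D - C.pt P) - C.pt P = C.K - D by abel] at h3
  simp at h2
  omega

theorem h1_mono {D E : C.Div} (h : ∀ P, D P ≤ E P) : C.h1 E ≤ C.h1 D :=
  h0_mono (C.H0_mono fun P => by have := h P; simp; omega)

theorem h0_sub_pt_lt {D : C.Div} {P : C.Point} {f : C.F} (hf : f ∈ C.H0 D)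
    (hfP : f ∉ C.H0 (D - C.pt P)) : C.h0 D = C.h0 (D - C.pt P) + 1 := by
  have h1 := h0_le_h0_sub_pt D P
  have h2 : C.h0 (D - C.pt P) < C.h0 D :=
    Submodule.finrank_lt_finrank_of_lt
      (lt_of_le_of_ne (H0_sub_pt_le D P) fun h => hfP (h ▸ hf))
  omega

theorem exists_of_h0_sub_pt_lt {D : C.Div} {P : C.Point} (h : C.h0 (D - C.pt P) < C.h0 D) :
    ∃ f ∈ C.H0 D, f ∉ C.H0 (D - C.pt P) := by
  by_contra! hc
  exact absurd (h0_mono (C := C) hc) (not_le.2 h)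

/-- A section not vanishing at `P` spans `H⁰(D)` modulo the sections vanishing at `P`. -/
theorem exists_sub_smul_mem {D : C.Div} {P : C.Point} {f x : C.F} (hf : f ∈ C.H0 D)
    (hfP : f ∉ C.H0 (D - C.pt P)) (hx : x ∈ C.H0 D) :
    ∃ c : ℂ, x - c • f ∈ C.H0 (D - C.pt P) := by
  have hle : C.H0 (D - C.pt P) ⊔ Submodule.span ℂ {f} ≤ C.H0 D :=
    sup_le (H0_sub_pt_le D P) ((Submodule.span_singleton_le_iff_mem _ _).2 hf)
  have hfin : FiniteDimensional ℂ (C.H0 (D - C.pt P) ⊔ Submodule.span ℂ {f} : Submodule ℂ C.F) :=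
    Submodule.finiteDimensional_of_le hle
  have hlt : C.H0 (D - C.pt P) < C.H0 (D - C.pt P) ⊔ Submodule.span ℂ {f} :=
    lt_of_le_of_ne le_sup_left fun h => hfP (h ▸ Submodule.mem_sup_right
      (Submodule.mem_span_singleton_self f))
  have h1 := Submodule.finrank_lt_finrank_of_lt hlt
  have h2 := h0_le_h0_sub_pt D P
  have h3 := Submodule.eq_of_le_of_finrank_le hle (by rw [h0, h0] at h2; omega)
  rw [← h3] at hx
  obtain ⟨y, hy, z, hz, rfl⟩ := Submodule.mem_sup.1 hx
  obtain ⟨c, rfl⟩ := Submodule.mem_span_singleton.1 hz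
  exact ⟨c, by simpa using hy⟩

theorem one_mem_H0 {D : C.Div} (h : ∀ P, 0 ≤ D P) : (1 : C.F) ∈ C.H0 D := by
  rw [mem_H0_iff one_ne_zero]
  intro P
  have h1 : C.ord P 1 = 0 := by simpa using C.ord_algebraMap P 1 one_ne_zero
  rw [h1, zero_add]
  exact h P

theorem H0_zero : C.H0 0 = Submodule.span ℂ {(1 : C.F)} := by
  refine (Submodule.eq_of_le_of_finrank_le ?_ ?_).symm
  · rw [Submodule.span_singleton_le_iff_mem]
    exact one_mem_H0 fun P => le_rfl
  · rw [finrank_span_singleton one_ne_zero]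
    exact C.h0_triv.le

theorem infinite_point : Infinite C.Point := by
  obtain ⟨x, hx, -⟩ := C.trdeg_one
  have hne : ∀ c : ℂ, x - algebraMap ℂ C.F c ≠ 0 := fun c hc =>
    hx (sub_eq_zero.1 hc ▸ isAlgebraic_algebraMap c)
  have hex : ∀ c : ℂ, ∃ P, 0 < C.ord P (x - algebraMap ℂ C.F c) := by
    intro c
    by_contra! hc
    have h1 := C.deg_principal _ (hne c)
    have h2 : ∀ P, C.ord P (x - algebraMap ℂ C.F c) = 0 := by
      by_contra! h2
      obtain ⟨P, hP⟩ := h2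
      have h3 : 0 < ∑ᶠ P, -C.ord P (x - algebraMap ℂ C.F c) :=
        finsum_pos (fun P => neg_nonneg.2 (hc P))
          ⟨P, neg_pos.2 (lt_of_le_of_ne (hc P) hP)⟩
          ((C.ord_finite_support _ (hne c)).subset fun P hP => by simpa using hP)
      rw [finsum_neg_distrib, h1] at h3
      simp at h3
    have h3 : x - algebraMap ℂ C.F c ∈ C.H0 0 := by
      rw [mem_H0_iff (hne c)]
      intro P
      simp [h2]
    rw [H0_zero, Submodule.mem_span_singleton] at h3
    obtain ⟨a, ha⟩ := h3
    refine hx ?_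
    rw [← sub_add_cancel x (algebraMap ℂ C.F c), ← ha, ← Algebra.algebraMap_eq_smul_one,
      ← map_add]
    exact isAlgebraic_algebraMap _
  choose p hp using hex
  refine Infinite.of_injective p fun c c' hcc => ?_
  by_contra hne'
  have h1 := hp c
  have h2 := hp c'
  rw [hcc] at h1
  have h3 : x - algebraMap ℂ C.F c + -(x - algebraMap ℂ C.F c') = algebraMap ℂ C.F (c' - c) := by
    rw [map_sub]; ring
  have h4 : c' - c ≠ 0 := sub_ne_zero.2 (Ne.symm hne')
  have h5 : -(x - algebraMap ℂ C.F c') = algebraMap ℂ C.F (-1) * (x - algebraMap ℂ C.F c') := by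
    simp
  have h6 : C.ord (p c') (-(x - algebraMap ℂ C.F c')) = C.ord (p c') (x - algebraMap ℂ C.F c') := by
    rw [h5, C.ord_mul _ _ _ (by simp) (hne c'), C.ord_algebraMap _ _ (by simp), zero_add]
  have h7 := C.ord_add (p c') (x - algebraMap ℂ C.F c) (-(x - algebraMap ℂ C.F c')) (hne c)
    (neg_ne_zero.2 (hne c')) (by rw [h3]; exact (map_ne_zero _).2 h4)
  rw [h3, C.ord_algebraMap _ _ h4, h6] at h7
  have := lt_min h1 h2
  omega

/-- A nonzero complete linear system drops in dimension at almost every point. -/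
theorem eventually_h0_sub_pt {D : C.Div} (h : 0 < C.h0 D) :
    ∀ᶠ P in Filter.cofinite, C.h0 D = C.h0 (D - C.pt P) + 1 := by
  obtain ⟨f, hf, hf0⟩ := h0_pos_iff.1 h
  have h1 : ∀ᶠ P in Filter.cofinite, C.ord P f = 0 := C.ord_finite_support f hf0
  have h2 : ∀ᶠ P in Filter.cofinite, D P = 0 := by
    refine D.support.finite_toSet.subset fun P hP => ?_
    simpa using hP
  filter_upwards [h1, h2] with P hP hP'
  refine h0_sub_pt_lt hf fun h => ((mem_H0_sub_pt hf0).1 h).2 ?_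
  rw [hP, hP', add_zero]

theorem eventually_h0_add_pt {D : C.Div} (h : C.h0 D = 0) (hd : C.deg D ≤ C.genus - 2) :
    ∀ᶠ P in Filter.cofinite, C.h0 (D + C.pt P) = 0 := by
  have h1 := C.riemann_roch D
  filter_upwards [eventually_h0_sub_pt (D := C.K - D) (by omega)] with P hP
  have h2 := C.riemann_roch (D + C.pt P)
  rw [deg_add, deg_pt, ← sub_sub] at h2
  omega

theorem h0_le_h0_add {A B : C.Div} (hB : 0 < C.h0 B) : C.h0 A ≤ C.h0 (A + B) := by
  obtain ⟨f, hf, hf0⟩ := h0_pos_iff.1 hB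
  refine LinearMap.finrank_le_finrank_of_injective
    (f := ((LinearMap.mulRight ℂ f).restrict (p := C.H0 A) (q := C.H0 (A + B))
      fun x hx => C.mul_mem_H0 hx hf)) ?_
  intro x y hxy
  exact Subtype.ext (mul_right_cancel₀ hf0 (congrArg Subtype.val hxy))

theorem h0_add_h0_le {A B : C.Div} (hA : 0 < C.h0 A) (hB : 0 < C.h0 B) :
    C.h0 A + C.h0 B ≤ C.h0 (A + B) + 1 := by
  obtain ⟨b, hb⟩ : ∃ b, C.h0 B = b + 1 := ⟨C.h0 B - 1, by omega⟩
  induction b generalizing B with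
  | zero => have := h0_le_h0_add (A := A) hB; omega
  | succ b ih =>
    have : Infinite C.Point := infinite_point
    have h1 := h0_le_h0_add (A := A) hB
    obtain ⟨P, hP, hP'⟩ := ((eventually_h0_sub_pt hB).and
      (eventually_h0_sub_pt (D := A + B) (by omega))).exists
    have h2 := ih (B := B - C.pt P) (by omega) (by omega)
    rw [← add_sub_assoc] at h2
    omega

/-- Clifford's inequality. -/
theorem clifford {D : C.Div} (h : 0 < C.h0 D) (h' : 0 < C.h1 D) :
    2 * (C.h0 D : ℤ) ≤ C.deg D + 2 := by
  have h2 := h0_add_h0_le h h'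
  rw [add_sub_cancel, h0_K] at h2
  have h3 := C.riemann_roch D
  omega

end Curve

/-! ### Divisors in general position -/

theorem exists_finset_of_eventually {α : Type} [DecidableEq α] {l : Filter α} [l.NeBot]
    (hl : l ≤ Filter.cofinite) {Ψ : Finset α → Prop} (h0 : Ψ ∅)
    (h : ∀ A, Ψ A → ∀ᶠ X in l, X ∉ A → Ψ (insert X A)) (m : ℕ) :
    ∃ Y : Finset α, Y.card = m ∧ ∀ A ⊆ Y, Ψ A := by
  induction m with
  | zero => exact ⟨∅, rfl, fun A hA => Finset.subset_empty.1 hA ▸ h0⟩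
  | succ m ih =>
    obtain ⟨Y, rfl, hY⟩ := ih
    have h1 : ∀ᶠ X in l, ∀ A ∈ Y.powerset, X ∉ A → Ψ (insert X A) :=
      (Filter.eventually_all_finset _).2 fun A hA => h A (hY A (Finset.mem_powerset.1 hA))
    have h2 : ∀ᶠ X in l, X ∉ Y := hl Y.finite_toSet.compl_mem_cofinite
    obtain ⟨X, hX, hXY⟩ := (h1.and h2).exists
    refine ⟨insert X Y, Finset.card_insert_of_notMem hXY, fun A hA => ?_⟩
    by_cases hXA : X ∈ A
    · rw [← Finset.insert_erase hXA]
      exact hX _ (Finset.mem_powerset.2 (Finset.subset_insert_iff.1 hA))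
        (Finset.notMem_erase X A)
    · exact hY A ((Finset.subset_insert_iff_of_notMem hXA).1 hA)

namespace Curve

open PreCurve

variable {C : Curve}

theorem divOfFinset_insert [DecidableEq C.Point] {A : Finset C.Point} {X : C.Point}
    (h : X ∉ A) : C.divOfFinset (insert X A) = C.divOfFinset A + C.pt X := by
  rw [divOfFinset, Finset.sum_insert h, add_comm, divOfFinset]

theorem divOfFinset_erase [DecidableEq C.Point] {A : Finset C.Point} {X : C.Point}
    (h : X ∈ A) : C.divOfFinset (A.erase X) = C.divOfFinset A - C.pt X := by
  rw [divOfFinset, Finset.sum_erase_eq_sub h, divOfFinset]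

theorem divOfFinset_nonneg (A : Finset C.Point) (Q : C.Point) : 0 ≤ C.divOfFinset A Q := by
  rw [divOfFinset, Finsupp.finsetSum_apply]
  exact Finset.sum_nonneg fun P _ => pt_nonneg P Q

/-- No divisor `A + P` is linearly equivalent to an effective one. -/
def IsFar (A : C.Div) : Prop := ∀ P, C.h0 (A + C.pt P) = 0

/-- An ultrafilter of generic points. -/
def generic (C : Curve) : Ultrafilter C.Point :=
  have := infinite_point (C := C)
  Filter.hyperfilter C.Point

theorem generic_le_cofinite : (generic C : Filter C.Point) ≤ Filter.cofinite :=
  have := infinite_point (C := C)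
  Filter.hyperfilter_le_cofinite

/-- The property `φ` holds after adding `n` generic points, chosen one after the other. -/
def Generically (φ : C.Div → Prop) : ℕ → C.Div → Prop
  | 0, A => φ A
  | n + 1, A => ∀ᶠ X in (generic C : Filter C.Point), Generically φ n (A + C.pt X)

theorem not_generically (φ : C.Div → Prop) (n : ℕ) (A : C.Div) :
    ¬ Generically φ n A ↔ Generically (fun B => ¬ φ B) n A := by
  induction n generalizing A with
  | zero => rfl
  | succ n ih =>
    rw [Generically, ← Ultrafilter.eventually_not, Generically]
    exact Filter.eventually_congr (Filter.Eventually.of_forall fun X => ih _)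

theorem eventually_generically_insert [DecidableEq C.Point] {φ : C.Div → Prop} {n : ℕ}
    {U : C.Div} {A : Finset C.Point}
    (h : ∀ k, A.card + k = n → Generically φ k (U + C.divOfFinset A)) :
    ∀ᶠ X in (generic C : Filter C.Point), X ∉ A → ∀ k, (insert X A).card + k = n →
      Generically φ k (U + C.divOfFinset (insert X A)) := by
  by_cases hk : ∃ k, A.card + (k + 1) = n
  · obtain ⟨k, hk⟩ := hk
    filter_upwards [h _ hk] with X hX hXA k' hk'
    rw [Finset.card_insert_of_notMem hXA] at hk'
    obtain rfl : k' = k := by omega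
    rwa [divOfFinset_insert hXA, ← add_assoc]
  · refine Filter.Eventually.of_forall fun X hXA k hk' => absurd ⟨k, ?_⟩ hk
    rw [Finset.card_insert_of_notMem hXA] at hk'
    omega

/-- Functions with poles outside `T` at distinct points are linearly independent. -/
theorem card_le_h0 {ι : Type} (S : Finset ι) {P : ι → C.Point} {f : ι → C.F} {T : C.Div}
    (hP : Set.InjOn P S) (hf : ∀ i ∈ S, f i ∈ C.H0 (T + C.pt (P i)))
    (hf' : ∀ i ∈ S, f i ∉ C.H0 T) : S.card ≤ C.h0 (T + ∑ i ∈ S, C.pt (P i)) := by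
  classical
  induction S using Finset.induction_on with
  | empty => simp
  | insert j S hj ih =>
    have ih := ih (hP.mono (by simp)) (fun i hi => hf i (Finset.mem_insert_of_mem hi))
      fun i hi => hf' i (Finset.mem_insert_of_mem hi)
    have h1 := hf j (Finset.mem_insert_self j S)
    have h2 := hf' j (Finset.mem_insert_self j S)
    have hj0 : f j ≠ 0 := fun h => h2 (h ▸ (C.H0 T).zero_mem)
    rw [← add_sub_cancel_right T (C.pt (P j)), mem_H0_sub_pt hj0] at h2
    have h3 : C.ord (P j) (f j) + (T + C.pt (P j)) (P j) = 0 := by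
      by_contra h
      exact h2 ⟨h1, h⟩
    have hnn : ∀ Q, 0 ≤ (∑ i ∈ S, C.pt (P i)) Q := fun Q => by
      rw [Finsupp.finsetSum_apply]
      exact Finset.sum_nonneg fun i _ => pt_nonneg _ Q
    have hz : (∑ i ∈ S, C.pt (P i)) (P j) = 0 := by
      rw [Finsupp.finsetSum_apply]
      refine Finset.sum_eq_zero fun i hi => pt_of_ne fun h => hj ?_
      rwa [hP (Finset.mem_insert_self j S) (Finset.mem_insert_of_mem hi) h]
    have h4 : f j ∈ C.H0 (T + ∑ i ∈ S, C.pt (P i) + C.pt (P j)) := by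
      refine C.H0_mono (fun Q => ?_) h1
      have := hnn Q
      simp only [Finsupp.add_apply]
      omega
    have h5 := h0_sub_pt_lt h4 fun h => ((mem_H0_sub_pt hj0).1 h).2 <| by
      rw [Finsupp.add_apply, Finsupp.add_apply, hz, add_zero, ← Finsupp.add_apply, h3]
    rw [Finset.sum_insert hj, Finset.card_insert_of_notMem hj, add_comm (C.pt _), ← add_assoc, h5,
      add_sub_cancel_right]
    omega

theorem exists_isFar_erase [DecidableEq C.Point] {n : ℕ} (hn : n ≤ C.genus + 1) {T : C.Div}
    (hT : C.deg T = n - 3) (hT0 : C.h0 T = 0) {Y : Finset C.Point} (hY : Y.card = n + 1)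
    (h : ∀ X ∈ Y, ∀ X' ∈ Y, X ≠ X' → IsFar (T - C.pt X - C.pt X')) :
    ∃ X ∈ Y, IsFar (T - C.pt X) := by
  by_contra! hc
  have hex : ∀ X : C.Point, ∃ (P : C.Point) (f : C.F),
      X ∈ Y → f ∈ C.H0 (T - C.pt X + C.pt P) ∧ f ≠ 0 := by
    intro X
    by_cases hX : X ∈ Y
    · have := hc X hX
      rw [IsFar] at this
      push Not at this
      obtain ⟨P, hP⟩ := this
      obtain ⟨f, hf⟩ := h0_pos_iff.1 (Nat.pos_of_ne_zero hP)
      exact ⟨P, f, fun _ => hf⟩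
    · exact ⟨X, 0, fun h => absurd h hX⟩
  choose P f hPf using hex
  have hf' : ∀ X ∈ Y, f X ∉ C.H0 T := fun X hX hf => (hPf X hX).2 (h0_eq_zero_iff.1 hT0 _ hf)
  have hf : ∀ X ∈ Y, f X ∈ C.H0 (T + C.pt (P X)) := fun X hX => by
    refine C.H0_mono (fun Q => ?_) (hPf X hX).1
    have := pt_nonneg X Q
    simp only [Finsupp.add_apply, Finsupp.sub_apply]
    omega
  have hinj : Set.InjOn P Y := by
    intro X hX X' hX' hXX
    by_contra hne
    obtain ⟨c, hc⟩ := exists_sub_smul_mem (P := P X) (hXX ▸ hf X' hX')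
      (by rw [add_sub_cancel_right]; exact hf' X' hX') (hf X hX)
    rw [add_sub_cancel_right] at hc
    have hc := h0_eq_zero_iff.1 hT0 _ hc
    have h1 : f X ∈ C.H0 (T + C.pt (P X) - C.pt X') := by
      rw [sub_eq_zero.1 hc, hXX, ← sub_add_eq_add_sub]
      exact Submodule.smul_mem _ c (hPf X' hX').1
    have h2 : f X ∈ C.H0 (T - C.pt X - C.pt X' + C.pt (P X)) := by
      rw [sub_add_eq_add_sub, mem_H0_sub_pt (hPf X hX).2]
      refine ⟨(hPf X hX).1, ?_⟩
      have := ((mem_H0_sub_pt (hPf X hX).2).1 h1).2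
      simpa [pt_of_ne (Ne.symm hne)] using this
    exact (hPf X hX).2 (h0_eq_zero_iff.1 (h X hX X' hX' hne (P X)) _ h2)
  have h1 := card_le_h0 Y hinj hf hf'
  set D := T + ∑ X ∈ Y, C.pt (P X)
  have h2 : C.deg D = 2 * n - 2 := by
    rw [deg_add, hT, deg_sum_pt, hY]
    push_cast
    ring
  have h3 := h0_sub_h1 D
  rcases Nat.eq_zero_or_pos (C.h1 D) with h4 | h4
  · omega
  · have := clifford (by omega) h4
    omega

theorem generically_isFar {U : C.Div} (hU : C.deg U = -4) {n : ℕ} (hn : n ≤ C.genus + 1) :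
    Generically IsFar n U := by
  classical
  induction n with
  | zero => exact fun P => h0_eq_zero_of_deg_neg (by simp [hU])
  | succ n ih =>
    have ih := ih (by omega)
    by_contra hc
    rw [not_generically] at hc
    obtain ⟨Y, hY, hYA⟩ := exists_finset_of_eventually (l := generic C) generic_le_cofinite
      (Ψ := fun A => (∀ k, A.card + k = n → Generically IsFar k (U + C.divOfFinset A)) ∧
        (∀ k, A.card + k = n + 1 → Generically (fun B => ¬ IsFar B) k (U + C.divOfFinset A)) ∧
        (A.card ≤ n + 2 → C.h0 (U + C.divOfFinset A) = 0))
      ⟨fun k hk => by simpa [divOfFinset, ← hk] using ih,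
        fun k hk => by
          obtain rfl : k = n + 1 := by simpa using hk
          simpa [divOfFinset] using hc,
        fun _ => h0_eq_zero_of_deg_neg (by simp [hU])⟩
      (fun A ⟨h1, h2, h3⟩ => by
        by_cases hA : A.card ≤ n + 1
        · filter_upwards [eventually_generically_insert h1, eventually_generically_insert h2,
            generic_le_cofinite (eventually_h0_add_pt (h3 (by omega)) (by simp [hU]; omega))]
            with X hX1 hX2 hX3 hXA
          refine ⟨hX1 hXA, hX2 hXA, fun _ => ?_⟩
          rw [divOfFinset_insert hXA, ← add_assoc]
          exact hX3
        · filter_upwards [eventually_generically_insert h1, eventually_generically_insert h2]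
            with X hX1 hX2 hXA
          refine ⟨hX1 hXA, hX2 hXA, fun h => ?_⟩
          rw [Finset.card_insert_of_notMem hXA] at h
          omega) (n + 2)
    obtain ⟨X, hX, hXfar⟩ := exists_isFar_erase hn (T := U + C.divOfFinset Y)
      (by rw [deg_add, deg_divOfFinset, hU, hY]; push_cast; ring)
      ((hYA Y subset_rfl).2.2 hY.le) hY fun X hX X' hX' hne => by
        have hX'' : X' ∈ Y.erase X := Finset.mem_erase.2 ⟨hne.symm, hX'⟩
        have := (hYA ((Y.erase X).erase X')
          ((Finset.erase_subset _ _).trans (Finset.erase_subset _ _))).1 0 (by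
            rw [Finset.card_erase_of_mem hX'', Finset.card_erase_of_mem hX]; omega)
        rw [divOfFinset_erase hX'', divOfFinset_erase hX, ← add_sub_assoc, ← add_sub_assoc] at this
        exact this
    refine (hYA (Y.erase X) (Finset.erase_subset _ _)).2.1 0
      (by rw [Finset.card_erase_of_mem hX]; omega) ?_
    rwa [divOfFinset_erase hX, ← add_sub_assoc]

theorem exists_general_finset {U : C.Div} (hU : C.deg U = -4) :
    ∃ Y : Finset C.Point, Y.card = C.genus + 1 ∧ IsFar (U + C.divOfFinset Y) ∧
      ∀ P, C.h1 (C.divOfFinset Y - C.pt P) = 0 := by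
  classical
  obtain ⟨Y, hY, hYA⟩ := exists_finset_of_eventually (l := generic C) generic_le_cofinite
    (Ψ := fun A => (∀ k, A.card + k = C.genus + 1 →
        Generically IsFar k (U + C.divOfFinset A)) ∧
      (A.card ≤ C.genus → C.h1 (C.divOfFinset A) + A.card = C.genus))
    ⟨fun k hk => by
        obtain rfl : k = C.genus + 1 := by simpa using hk
        simpa [divOfFinset] using generically_isFar hU le_rfl,
      fun _ => by simp [divOfFinset, h1, h0_K]⟩
    (fun A ⟨h1, h2⟩ => by
      by_cases hA : A.card + 1 ≤ C.genus
      · have h2 := h2 (by omega)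
        filter_upwards [eventually_generically_insert h1, generic_le_cofinite
          (eventually_h0_sub_pt (D := C.K - C.divOfFinset A) (by rw [Curve.h1] at h2; omega))]
          with X hX1 hX2 hXA
        refine ⟨hX1 hXA, fun _ => ?_⟩
        rw [divOfFinset_insert hXA, Finset.card_insert_of_notMem hXA, Curve.h1, ← sub_sub]
        rw [Curve.h1] at h2
        omega
      · filter_upwards [eventually_generically_insert h1] with X hX1 hXA
        refine ⟨hX1 hXA, fun h => ?_⟩
        rw [Finset.card_insert_of_notMem hXA] at h
        omega) (C.genus + 1)
  have h1 : ∀ X ∈ Y, C.h1 (C.divOfFinset Y - C.pt X) = 0 := by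
    intro X hX
    rw [← divOfFinset_erase hX]
    have hcard : (Y.erase X).card = C.genus := by
      rw [Finset.card_erase_of_mem hX, hY, Nat.add_sub_cancel]
    have := (hYA (Y.erase X) (Finset.erase_subset _ _)).2 hcard.le
    omega
  refine ⟨Y, hY, (hYA Y subset_rfl).1 0 hY, fun P => ?_⟩
  by_cases hP : P ∈ Y
  · exact h1 P hP
  · obtain ⟨X, hX⟩ : Y.Nonempty := Finset.card_pos.1 (by omega)
    have h2 : C.h1 (C.divOfFinset Y) = 0 := by
      refine Nat.eq_zero_of_le_zero ((h1_mono fun Q => ?_).trans (h1 X hX).le)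
      have := pt_nonneg X Q
      simp only [Finsupp.sub_apply]
      omega
    have h3 := h0_sub_pt_lt (P := P) (one_mem_H0 (divOfFinset_nonneg Y)) fun h =>
      ((mem_H0_sub_pt one_ne_zero).1 h).2 ?_
    · have h4 := h0_sub_h1 (C.divOfFinset Y)
      have h5 := h0_sub_h1 (C.divOfFinset Y - C.pt P)
      rw [deg_sub, deg_pt] at h5
      omega
    · have h6 : C.ord P 1 = 0 := by simpa using C.ord_algebraMap P 1 one_ne_zero
      rw [h6, zero_add, divOfFinset, Finsupp.finsetSum_apply]
      exact Finset.sum_eq_zero fun X hX => pt_of_ne fun h => hP (h ▸ hX)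

end Curve

/-! ### Linear resolutions of section modules -/

namespace Curve

open PreCurve LinearRes

variable {C : Curve}

theorem mul_mem_H0_sub_pt_iff {D E : C.Div} {P : C.Point} {f r : C.F} (hf : f ∈ C.H0 E)
    (hfP : f ∉ C.H0 (E - C.pt P)) (hr : r ∈ C.H0 D) :
    r * f ∈ C.H0 (D + E - C.pt P) ↔ r ∈ C.H0 (D - C.pt P) := by
  rcases eq_or_ne r 0 with rfl | hr0
  · simp
  have hf0 : f ≠ 0 := fun h => hfP (h ▸ (C.H0 _).zero_mem)
  have h1 : C.ord P f + E P = 0 := by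
    by_contra h
    exact hfP ((mem_H0_sub_pt hf0).2 ⟨hf, h⟩)
  rw [mem_H0_sub_pt (mul_ne_zero hr0 hf0), mem_H0_sub_pt hr0, C.ord_mul P r f hr0 hf0,
    Finsupp.add_apply, add_add_add_comm, h1, add_zero]
  exact and_congr_left fun _ => ⟨fun _ => hr, fun _ => C.mul_mem_H0 hr hf⟩

theorem h1_eq_zero_of_le {A B : C.Div} (h : ∀ P, 0 ≤ B P) (hA : C.h1 A = 0) :
    C.h1 (A + B) = 0 :=
  Nat.eq_zero_of_le_zero ((h1_mono fun P => by simpa using h P).trans hA.le)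

theorem h0_sub_pt_lt_of_h1 {A : C.Div} {P : C.Point} (h : C.h1 (A - C.pt P) = 0) :
    C.h0 (A - C.pt P) < C.h0 A := by
  have h2 := h0_sub_h1 A
  have h3 := h0_sub_h1 (A - C.pt P)
  rw [deg_sub, deg_pt] at h3
  omega

theorem h1_eq_zero_of_sub_pt {A : C.Div} (h : ∀ P, C.h1 (A - C.pt P) = 0) : C.h1 A = 0 := by
  have := infinite_point (C := C)
  obtain ⟨P⟩ : Nonempty C.Point := inferInstance
  rw [← sub_add_cancel A (C.pt P)]
  exact h1_eq_zero_of_le (pt_nonneg P) (h P)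

theorem deg_nonneg {G : C.Div} (h : ∀ P, 0 ≤ G P) : 0 ≤ C.deg G :=
  Finset.sum_nonneg fun P _ => h P

/-- The graded `R_L`-module `⊕ₙ H⁰(A + nL)` has a resolution which is linear in the first
`i` steps. -/
def IsLinear (L : C.Div) (i : ℕ) (A : C.Div) : Prop :=
  IsLin (fun n => C.H0 (n • L)) i C.F fun n => C.H0 (A + n • L)

theorem h0_nsmul_sub_pt_lt {L : C.Div} (hL : 2 * (C.genus : ℤ) ≤ C.deg L) (P : C.Point) (n : ℕ) :
    C.h0 (n • L - C.pt P) < C.h0 (n • L) := by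
  rcases n with - | n
  · rw [zero_smul, C.h0_triv, h0_eq_zero_of_deg_neg (by rw [deg_sub, deg_zero, deg_pt]; omega)]
    exact one_pos
  · refine h0_sub_pt_lt_of_h1 (h1_eq_zero_of_deg ?_)
    rw [deg_sub, deg_pt, deg_nsmul]
    push_cast
    nlinarith

theorem isLinear_of_sub_pt {L : C.Div} (hL : 2 * (C.genus : ℤ) ≤ C.deg L) {i : ℕ} {A : C.Div}
    {P : C.Point} (hA : C.h0 (A - C.pt P) < C.h0 A) (h1 : IsLinear L (i + 1) (A - C.pt P))
    (h2 : IsLinear L i (L - C.pt P)) : IsLinear L (i + 1) A := by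
  obtain ⟨f, hf, hfP⟩ := exists_of_h0_sub_pt_lt hA
  have hdiv : ∀ n : ℕ, A - C.pt P + n • L = n • L + A - C.pt P := fun n => by abel
  refine isLin_of_adjoin (fun m n r s hr hs => (C.RL L).mul_mem hr hs) f (by simpa using hf)
    (by simpa using hfP) (fun n => ?_) (fun n r x hr hx => ?_) (fun n x hx => ?_) (fun n r => ?_)
    h1 h2
  · rw [hdiv, add_comm A]
    exact H0_sub_pt_le _ P
  · rw [smul_eq_mul, add_comm _ (n • L)]
    exact C.mul_mem_H0 hr (by simpa using hx)
  · obtain ⟨r, hr, hrP⟩ := exists_of_h0_sub_pt_lt (h0_nsmul_sub_pt_lt hL P n)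
    rw [add_comm] at hx
    obtain ⟨c, hc⟩ := exists_sub_smul_mem (C.mul_mem_H0 hr hf)
      (fun h => hrP ((mul_mem_H0_sub_pt_iff hf hfP hr).1 h)) hx
    refine ⟨c • r, Submodule.smul_mem _ c hr, ?_⟩
    rw [hdiv, smul_assoc]
    exact hc
  · have hdiv' : L - C.pt P + n • L = (n + 1) • L - C.pt P := by rw [succ_nsmul]; abel
    rw [hdiv, hdiv', smul_eq_mul]
    constructor
    · intro hr
      have hr' := H0_sub_pt_le _ P hr
      exact ⟨hr', (mul_mem_H0_sub_pt_iff hf hfP hr').2 hr⟩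
    · rintro ⟨hr, hr'⟩
      exact (mul_mem_H0_sub_pt_iff hf hfP hr).1 hr'

theorem IsLinear.add_of_succ {L : C.Div} (hL : 2 * (C.genus : ℤ) ≤ C.deg L) {i : ℕ} {B G : C.Div}
    (hB : C.h1 B = 0) (h : IsLinear L (i + 1) B) (hG : ∀ P, 0 ≤ G P)
    (hP : ∀ P, 0 < G P → IsLinear L i (L - C.pt P)) : IsLinear L (i + 1) (B + G) := by
  induction hm : (C.deg G).toNat using Nat.strong_induction_on generalizing G with
  | _ m ih =>
    by_cases hex : ∃ P, 0 < G P
    · obtain ⟨P, hGP⟩ := hex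
      have hG' : ∀ Q, 0 ≤ (G - C.pt P) Q := fun Q => by
        have := hG Q
        rcases eq_or_ne Q P with rfl | hQ
        · rw [Finsupp.sub_apply, pt_self]; omega
        · rw [Finsupp.sub_apply, pt_of_ne hQ]; omega
      have hdeg := deg_nonneg hG'
      rw [deg_sub, deg_pt] at hdeg
      refine isLinear_of_sub_pt (P := P) hL (h0_sub_pt_lt_of_h1 ?_) ?_ (hP P hGP)
      · rw [add_sub_assoc]
        exact h1_eq_zero_of_le hG' hB
      · rw [add_sub_assoc]
        refine ih _ ?_ hG' (fun Q hQ => hP Q ?_) rfl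
        · rw [deg_sub, deg_pt]; omega
        · have := pt_nonneg P Q
          rw [Finsupp.sub_apply] at hQ
          omega
    · push Not at hex
      obtain rfl : G = 0 := Finsupp.ext fun P => le_antisymm (hex P) (hG P)
      rwa [add_zero]

theorem IsLinear.add {L : C.Div} (hL : 2 * (C.genus : ℤ) ≤ C.deg L) {i : ℕ} {B G : C.Div}
    (hB : C.h1 B = 0) (h : IsLinear L i B) (hG : ∀ P, 0 ≤ G P)
    (hP : ∀ P, 0 < G P → IsLinear L i (L - C.pt P)) : IsLinear L i (B + G) := by
  cases i with
  | zero => trivial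
  | succ i => exact h.add_of_succ hL hB hG fun P h => (hP P h).of_succ

/-! ### Base-point free pencils -/

section Pencil

variable {D : C.Div} {b : Fin 2 → C.F}

/-- Division by a base-point free pencil. -/
theorem mem_H0_of_mul_mem (hb : Submodule.span ℂ (Set.range b) = C.H0 D)
    (hbpf : ∀ P, C.h0 (D - C.pt P) < C.h0 D) {B : C.Div} {c : C.F}
    (hc : ∀ j, c * b j ∈ C.H0 (B + D)) : c ∈ C.H0 B := by
  rcases eq_or_ne c 0 with rfl | hc0
  · exact (C.H0 B).zero_mem
  refine (mem_H0_iff hc0).2 fun P => ?_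
  obtain ⟨j, hj⟩ : ∃ j, b j ∉ C.H0 (D - C.pt P) := by
    by_contra! h
    refine (hbpf P).not_ge (h0_mono ?_)
    rw [← hb, Submodule.span_le]
    rintro _ ⟨j, rfl⟩
    exact h j
  have hbj : b j ∈ C.H0 D := hb ▸ Submodule.subset_span ⟨j, rfl⟩
  have hj0 : b j ≠ 0 := fun h => hj (h ▸ (C.H0 _).zero_mem)
  have h1 : C.ord P (b j) + D P = 0 := by
    by_contra h
    exact hj ((mem_H0_sub_pt hj0).2 ⟨hbj, h⟩)
  have h2 := (mem_H0_iff (mul_ne_zero hc0 hj0)).1 (hc j) P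
  rw [C.ord_mul P c _ hc0 hj0, Finsupp.add_apply] at h2
  omega

/-- The base-point free pencil trick. -/
theorem mul_inv_mem_H0 (hb : Submodule.span ℂ (Set.range b) = C.H0 D) (hb1 : b 1 ≠ 0)
    (hbpf : ∀ P, C.h0 (D - C.pt P) < C.h0 D) {B : C.Div} {v w : C.F} (hv : v ∈ C.H0 (B + D))
    (hw : w ∈ C.H0 (B + D)) (h : v * b 0 + w * b 1 = 0) : v * (b 1)⁻¹ ∈ C.H0 B := by
  refine mem_H0_of_mul_mem hb hbpf fun j => ?_
  fin_cases j
  · have : v * (b 1)⁻¹ * b 0 = -w := by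
      field_simp
      linear_combination h
    simpa [this] using hw
  · simpa [hb1] using hv

theorem exists_mul_add_mul_eq (hb : Submodule.span ℂ (Set.range b) = C.H0 D) (hb1 : b 1 ≠ 0)
    (hbpf : ∀ P, C.h0 (D - C.pt P) < C.h0 D) {B : C.Div}
    (hdim : C.h0 (D + B) + C.h0 (B - D) ≤ 2 * C.h0 B) {x : C.F} (hx : x ∈ C.H0 (D + B)) :
    ∃ v ∈ C.H0 B, ∃ w ∈ C.H0 B, v * b 0 + w * b 1 = x := by
  have hbj : ∀ j, b j ∈ C.H0 D := fun j => hb ▸ Submodule.subset_span ⟨j, rfl⟩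
  let Φ : (C.H0 B × C.H0 B) →ₗ[ℂ] C.F :=
    ((LinearMap.mulRight ℂ (b 0)).comp (C.H0 B).subtype).coprod
      ((LinearMap.mulRight ℂ (b 1)).comp (C.H0 B).subtype)
  have hΦ : ∀ p, Φ p = p.1 * b 0 + p.2 * b 1 := fun p => rfl
  have hle : LinearMap.range Φ ≤ C.H0 (D + B) := by
    rintro _ ⟨p, rfl⟩
    rw [hΦ, add_comm D]
    exact add_mem (C.mul_mem_H0 p.1.2 (hbj 0)) (C.mul_mem_H0 p.2.2 (hbj 1))
  let ψ : LinearMap.ker Φ →ₗ[ℂ] C.H0 (B - D) :=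
    LinearMap.codRestrict _ ((LinearMap.mulRight ℂ (b 1)⁻¹).comp ((C.H0 B).subtype.comp
      ((LinearMap.fst ℂ _ _).comp (LinearMap.ker Φ).subtype))) fun p =>
        mul_inv_mem_H0 hb hb1 hbpf (v := p.1.1) (w := p.1.2) (by simp) (by simp) p.2
  have hψ : Injective ψ := by
    rintro ⟨⟨v, w⟩, hp⟩ ⟨⟨v', w'⟩, hp'⟩ h
    have h1 : (v : C.F) * (b 1)⁻¹ = v' * (b 1)⁻¹ := congrArg Subtype.val h
    have h2 : (v : C.F) = v' := mul_right_cancel₀ (inv_ne_zero hb1) h1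
    have h3 : (v : C.F) * b 0 + w * b 1 = 0 := hp
    have h4 : (v' : C.F) * b 0 + w' * b 1 = 0 := hp'
    have h5 : (w : C.F) = w' :=
      mul_right_cancel₀ hb1 (by linear_combination h3 - h4 - b 0 * h2)
    exact Subtype.ext (Prod.ext (Subtype.ext h2) (Subtype.ext h5))
  have h1 : Module.finrank ℂ (LinearMap.ker Φ) ≤ C.h0 (B - D) :=
    LinearMap.finrank_le_finrank_of_injective hψ
  have h2 := LinearMap.finrank_range_add_finrank_ker Φ
  rw [Module.finrank_prod] at h2
  have h3 : LinearMap.range Φ = C.H0 (D + B) :=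
    Submodule.eq_of_le_of_finrank_le hle (by rw [h0, h0, h0] at *; omega)
  rw [← h3] at hx
  obtain ⟨p, rfl⟩ := hx
  exact ⟨p.1, p.1.2, p.2, p.2.2, rfl⟩

end Pencil

theorem isLinear_of_pencil {L : C.Div} (hL : 2 * (C.genus : ℤ) + 2 ≤ C.deg L) {i : ℕ} {D : C.Div}
    (hD : C.deg D = C.genus + 1) (hbpf : ∀ P, C.h1 (D - C.pt P) = 0) (hLD : C.h1 (L - D) = 0)
    (h : IsLinear L i (L - D)) : IsLinear L (i + 1) D := by
  have hbpf' := fun P => h0_sub_pt_lt_of_h1 (hbpf P)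
  have hD1 := h1_eq_zero_of_sub_pt hbpf
  have hD2 : C.h0 D = 2 := by
    have := h0_sub_h1 D
    omega
  let β := Module.finBasisOfFinrankEq ℂ (C.H0 D) hD2
  let b : Fin 2 → C.F := fun j => β j
  have hbi : LinearIndependent ℂ b :=
    β.linearIndependent.map' (C.H0 D).subtype (Submodule.ker_subtype _)
  have hb : Submodule.span ℂ (Set.range b) = C.H0 D := by
    have := congrArg (Submodule.map (C.H0 D).subtype) β.span_eq
    rw [Submodule.map_span, Submodule.map_subtype_top, ← Set.range_comp] at this
    exact this
  have hb1 : b 1 ≠ 0 := hbi.ne_zero 1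
  refine ⟨Fin 2, inferInstance, b, ⟨hbi, fun j => ?_, fun n x hx => ?_⟩, ?_⟩
  · rw [zero_smul, add_zero]
    exact (β j).2
  · have hdim : C.h0 (D + n • L) + C.h0 (n • L - D) ≤ 2 * C.h0 (n • L) := by
      rcases n with - | n
      · rw [zero_smul, add_zero, C.h0_triv, hD2, h0_eq_zero_of_deg_neg]
        rw [deg_sub, deg_zero, hD]
        omega
      · have h1 : C.h1 ((n + 1) • L - D) = 0 := by
          rcases n with - | n
          · simpa using hLD
          · refine h1_eq_zero_of_deg ?_
            rw [deg_sub, deg_nsmul, hD]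
            push_cast
            nlinarith
        have h2 : C.h1 (D + (n + 1) • L) = 0 := by
          refine h1_eq_zero_of_deg ?_
          rw [deg_add, deg_nsmul, hD]
          push_cast
          nlinarith
        have h3 := h0_sub_h1 (D + (n + 1) • L)
        have h4 := h0_sub_h1 ((n + 1) • L - D)
        have h5 := h0_sub_h1 ((n + 1) • L)
        rw [deg_add] at h3
        rw [deg_sub] at h4
        omega
    obtain ⟨v, hv, w, hw, rfl⟩ := exists_mul_add_mul_eq hb hb1 hbpf' hdim hx
    refine ⟨![v, w], fun j => ?_, by simp⟩
    fin_cases j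
    · exact hv
    · exact hw
  · refine IsLin.map (LinearMap.toSpanSingleton C.F (Fin 2 → C.F) ![b 1, -b 0]) ?_ ?_ h
    · intro c c' hcc
      exact mul_right_cancel₀ hb1 (congrFun hcc 0)
    · intro n v
      have hdiv : L - D + n • L + D = (n + 1) • L := by rw [succ_nsmul]; abel
      rw [mem_syz, Fin.sum_univ_two, smul_eq_mul, smul_eq_mul, Fin.forall_fin_two]
      constructor
      · rintro ⟨⟨hv, hw⟩, hvw⟩
        refine ⟨v 0 * (b 1)⁻¹, mul_inv_mem_H0 hb hb1 hbpf' (hdiv ▸ hv) (hdiv ▸ hw) hvw, ?_⟩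
        ext j
        fin_cases j
        · simp [hb1]
        · simp
          field_simp
          linear_combination -hvw
      · rintro ⟨c, hc, rfl⟩
        have hbj : ∀ j, c * b j ∈ C.H0 ((n + 1) • L) := fun j =>
          hdiv ▸ C.mul_mem_H0 hc (hb ▸ Submodule.subset_span ⟨j, rfl⟩)
        refine ⟨⟨by simpa using hbj 1, by simpa using hbj 0⟩, ?_⟩
        simp
        ring

theorem isLinear_of_pencils {L : C.Div} (hL : 2 * (C.genus : ℤ) + 2 ≤ C.deg L) {D D' E : C.Div}
    (hDE : D + D' + E = L) (hD : C.deg D = C.genus + 1) (hD' : C.deg D' = C.genus + 1)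
    (hbpf : ∀ P, C.h1 (D - C.pt P) = 0) (hbpf' : ∀ P, C.h1 (D' - C.pt P) = 0)
    (hDn : ∀ P, 0 ≤ D P) (hEn : ∀ P, 0 ≤ E P) (i : ℕ) :
    IsLinear L i D ∧ IsLinear L i D' ∧ ∀ P, 0 < (D + E) P → IsLinear L i (L - C.pt P) := by
  have hL' : 2 * (C.genus : ℤ) ≤ C.deg L := by omega
  have hD1 := h1_eq_zero_of_sub_pt hbpf
  have hD1' := h1_eq_zero_of_sub_pt hbpf'
  induction i with
  | zero => exact ⟨trivial, trivial, fun _ _ => trivial⟩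
  | succ i ih =>
    obtain ⟨h1, h2, h3⟩ := ih
    have hE : ∀ P, 0 < E P → IsLinear L i (L - C.pt P) := fun P hP => h3 P <| by
      have := hDn P
      rw [Finsupp.add_apply]
      omega
    have e1 : L - D = D' + E := by rw [← hDE]; abel
    have e2 : L - D' = D + E := by rw [← hDE]; abel
    have h4 : IsLinear L (i + 1) D := isLinear_of_pencil hL hD hbpf
      (e1 ▸ h1_eq_zero_of_le hEn hD1') (e1 ▸ h2.add hL' hD1' hEn hE)
    have h5 : IsLinear L (i + 1) D' := isLinear_of_pencil hL hD' hbpf'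
      (e2 ▸ h1_eq_zero_of_le hEn hD1) (e2 ▸ h1.add hL' hD1 hEn hE)
    refine ⟨h4, h5, fun P hP => ?_⟩
    rw [show L - C.pt P = D' + (D + E - C.pt P) by rw [← hDE]; abel]
    refine h5.add_of_succ hL' hD1' (fun Q => ?_) fun Q hQ => h3 Q ?_
    · rcases eq_or_ne Q P with rfl | hQ
      · rw [Finsupp.sub_apply, pt_self]; omega
      · have := hDn Q
        have := hEn Q
        rw [Finsupp.sub_apply, pt_of_ne hQ, Finsupp.add_apply]; omega
    · have := pt_nonneg P Q
      rw [Finsupp.sub_apply] at hQ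
      omega

theorem exists_pencils {L : C.Div} (hL : 2 * (C.genus : ℤ) + 2 ≤ C.deg L) :
    ∃ D D' E : C.Div, D + D' + E = L ∧ C.deg D = C.genus + 1 ∧ C.deg D' = C.genus + 1 ∧
      (∀ P, C.h1 (D - C.pt P) = 0) ∧ (∀ P, C.h1 (D' - C.pt P) = 0) ∧
      (∀ P, 0 ≤ D P) ∧ ∀ P, 0 ≤ E P := by
  have := infinite_point (C := C)
  obtain ⟨X⟩ : Nonempty C.Point := inferInstance
  obtain ⟨e, he⟩ := Int.eq_ofNat_of_zero_le (sub_nonneg.2 hL)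
  obtain ⟨Y, hY, hfar, hbpf⟩ := exists_general_finset (C := C) (U := C.K - (L - e • C.pt X))
    (by simp [deg_K]; omega)
  refine ⟨C.divOfFinset Y, L - C.divOfFinset Y - e • C.pt X, e • C.pt X, by abel, by simp [hY],
    by simp [hY]; omega, hbpf, fun P => ?_, divOfFinset_nonneg Y, fun P => ?_⟩
  · rw [h1, ← hfar P]
    congr 1
    abel
  · rw [Finsupp.smul_apply]
    exact nsmul_nonneg (pt_nonneg X P) e

theorem isLinear_self {L : C.Div} (hL : 2 * (C.genus : ℤ) + 2 ≤ C.deg L) (i : ℕ) :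
    IsLinear L i L := by
  obtain ⟨D, D', E, hDE, hD, hD', hbpf, hbpf', hDn, hEn⟩ := exists_pencils hL
  obtain ⟨-, h1, h2⟩ := isLinear_of_pencils hL hDE hD hD' hbpf hbpf' hDn hEn i
  have h3 := h1.add (by omega) (h1_eq_zero_of_sub_pt hbpf') (G := D + E)
    (fun P => add_nonneg (hDn P) (hEn P)) h2
  rwa [show D' + (D + E) = L by rw [← hDE]; abel] at h3

end Curve

/-!  ### STATEMENT 7

For any smooth connected projective complex curve of genus `g` and any line bundle
(=divisor class) `L` of degree `≥ 2g+2`, the homogeneous coordinate algebra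
`R_L = ⊕_{n≥0} H⁰(C, Lⁿ)` is Koszul. -/
theorem koszul_of_large_degree (C : Curve) (L : C.Div)
    (hL : 2 * (C.genus : ℤ) + 2 ≤ C.deg L) :
    (C.RL L).IsKoszul := by
  refine LinearRes.isKoszul_of_isLin _ ?_ fun i => ?_
  · rw [GradedSystem.ConnectedOne, ← Curve.H0_zero, ← zero_smul ℕ L]
    rfl
  · have h : (fun n => (C.RL L).piece (n + 1)) = fun n => C.H0 (L + n • L) := funext fun n => by
      rw [← succ_nsmul']
      rfl
    rw [h]
    exact Curve.isLinear_self hL i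

end
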